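/- arXiv:2603.17819 — 7 statements merged into one kernel-verified Lean document; each statement's English description precedes it below -/
import Mathlib

section
/- Let B = (β_n)_{n∈ℤ} be a Cantor real base. Suppose (a_n)_{n∈ℤ} is a sequence of nonnegative integers for which there exists N ∈ ℤ with a_n = 0 for all n ≥ N and such that val_B((a_n)) < +∞. Then (a_n)_{n∈ℤ} is the B-expansion of the real number val_B((a_n)) (i.e., it is radix-greatest among all B-representations of that number) if and only if both: (i) for all k ≥ 0, ∑_{n=0}^{k} a_n·β_{n-1}⋯β_0 + ∑_{n=1}^{∞} a_{-n}/(β_{-1}⋯β_{-n}) < β_k·β_{k-1}⋯β_0, and (ii) for all k ≥ 1, ∑_{n=k}^{∞} a_{-n}/(β_{-1}⋯β_{-n}) < 1/(β_{-1}⋯β_{-k+1}). -/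
open Filter

/-- A Cantor real base: a bi-infinite sequence of reals, all `> 1`, whose partial products
in both directions tend to infinity. -/
def IsCantorBase (B : ℤ → ℝ) : Prop :=
  (∀ n, 1 < B n) ∧
  Tendsto (fun N : ℕ => ∏ i ∈ Finset.range N, B (i + 1)) atTop atTop ∧
  Tendsto (fun N : ℕ => ∏ i ∈ Finset.range N, B (-(i + 1))) atTop atTop

/-- The value of a bi-infinite digit sequence in base `B`. -/
noncomputable def valB (B : ℤ → ℝ) (a : ℤ → ℕ) : ℝ :=
  (∑' n : ℕ, (a n : ℝ) * ∏ i ∈ Finset.range n, B i) +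
  ∑' n : ℕ, (a (-(n + 1)) : ℝ) / ∏ i ∈ Finset.range (n + 1), B (-(i + 1))

/-- The digits vanish from some index on (left tail of zeros). -/
def LeftVanishing (a : ℤ → ℕ) : Prop := ∃ N : ℤ, ∀ n ≥ N, a n = 0

/-- Summability of the fractional part (i.e. `val_B` is finite). -/
def NegSummable (B : ℤ → ℝ) (a : ℤ → ℕ) : Prop :=
  Summable (fun n : ℕ => (a (-(n + 1)) : ℝ) / ∏ i ∈ Finset.range (n + 1), B (-(i + 1)))

/-- `a` is a `B`-representation of the real number `x`. -/
def IsRep (B : ℤ → ℝ) (a : ℤ → ℕ) (x : ℝ) : Prop :=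
  LeftVanishing a ∧ NegSummable B a ∧ valB B a = x

/-- The radix order on bi-infinite digit sequences. -/
def radixLt (a b : ℤ → ℕ) : Prop := ∃ i : ℤ, (∀ j > i, a j = b j) ∧ a i < b i

def radixLe (a b : ℤ → ℕ) : Prop := a = b ∨ radixLt a b

/-- The place value of index `n` in base `B`, extended to all integers. -/
noncomputable def placeValue (B : ℤ → ℝ) : ℤ → ℝ
  | Int.ofNat n => ∏ i ∈ Finset.range n, B i
  | Int.negSucc n => (∏ i ∈ Finset.range (n + 1), B (-(i + 1)))⁻¹

theorem placeValue_natCast (B : ℤ → ℝ) (n : ℕ) :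
    placeValue B n = ∏ i ∈ Finset.range n, B i := rfl

theorem placeValue_neg_natCast (B : ℤ → ℝ) (n : ℕ) :
    placeValue B (-n) = (∏ i ∈ Finset.range n, B (-(i + 1)))⁻¹ := by
  cases n with
  | zero => simpa using placeValue_natCast B 0
  | succ n => rfl

theorem placeValue_pos {B : ℤ → ℝ} (hB : ∀ n, 1 < B n) (n : ℤ) : 0 < placeValue B n := by
  have h (n : ℤ) : 0 < B n := one_pos.trans (hB n)
  obtain ⟨m, rfl | rfl⟩ := n.eq_nat_or_neg
  · rw [placeValue_natCast]
    exact Finset.prod_pos fun i _ => h _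
  · rw [placeValue_neg_natCast]
    exact inv_pos.2 (Finset.prod_pos fun i _ => h _)

theorem tendsto_placeValue_sub {B : ℤ → ℝ} (hB : IsCantorBase B) (k : ℤ) :
    Tendsto (fun n : ℕ => placeValue B (k - n)) atTop (nhds 0) := by
  have h : Tendsto (fun n : ℕ => placeValue B (-n)) atTop (nhds 0) := by
    simp only [placeValue_neg_natCast]
    exact hB.2.2.inv_tendsto_atTop
  have hk : Tendsto (fun n : ℕ => ((n : ℤ) - k).toNat) atTop atTop := by
    refine tendsto_atTop.2 fun m => ?_
    filter_upwards [eventually_ge_atTop (m + k.toNat)] with n hn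
    omega
  refine (h.comp hk).congr' ?_
  filter_upwards [eventually_ge_atTop k.toNat] with n hn
  simp only [Function.comp_apply]
  congr 1
  omega

/-- The digits of a nonnegative real along null place values, found by the greedy algorithm. -/
theorem exists_hasSum_digits {w : ℕ → ℝ} (hw : ∀ n, 0 < w n) (hw0 : Tendsto w atTop (nhds 0))
    {x : ℝ} (hx : 0 ≤ x) : ∃ d : ℕ → ℕ, HasSum (fun n => (d n : ℝ) * w n) x := by
  let r : ℕ → ℝ := fun n => Nat.rec x (fun n y => y - ⌊y / w n⌋₊ * w n) n
  have hr (n : ℕ) : r (n + 1) = r n - ⌊r n / w n⌋₊ * w n := rfl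
  have hr0 (n : ℕ) : 0 ≤ r n := by
    induction n with
    | zero => exact hx
    | succ n ih =>
      rw [hr, sub_nonneg, ← le_div_iff₀ (hw n)]
      exact Nat.floor_le (div_nonneg ih (hw n).le)
  have hrw (n : ℕ) : r (n + 1) ≤ w n := by
    have := (div_lt_iff₀ (hw n)).1 (Nat.lt_floor_add_one (r n / w n))
    rw [hr]
    linarith
  have hlim : Tendsto r atTop (nhds 0) :=
    (tendsto_add_atTop_iff_nat 1).1 (squeeze_zero (fun n => hr0 (n + 1)) hrw hw0)
  refine ⟨fun n => ⌊r n / w n⌋₊, ?_⟩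
  rw [hasSum_iff_tendsto_nat_of_nonneg fun n => mul_nonneg (Nat.cast_nonneg _) (hw n).le]
  have hs (n : ℕ) : ∑ i ∈ Finset.range n, (⌊r i / w i⌋₊ : ℝ) * w i = x - r n := by
    induction n with
    | zero => simp [r]
    | succ n ih => rw [Finset.sum_range_succ, ih, hr]; ring
  simp only [hs]
  simpa using hlim.const_sub x

theorem HasSum.of_int_split {f : ℤ → ℝ} {s t : ℝ} (k : ℤ)
    (hs : HasSum (fun n : ℕ => f (k - n)) s) (ht : HasSum (fun n : ℕ => f (k + 1 + n)) t) :
    HasSum f (s + t) := by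
  rw [← (Equiv.subLeft k).hasSum_iff]
  refine HasSum.of_nat_of_neg_add_one hs ?_
  refine ht.congr_fun fun n => ?_
  simp only [Function.comp_apply, Equiv.subLeft_apply]
  ring_nf

theorem Summable.int_lower {f : ℤ → ℝ} (hf : Summable f) (k : ℤ) :
    Summable fun n : ℕ => f (k - n) :=
  hf.comp_injective fun m n h => by simpa using h

theorem Summable.int_upper {f : ℤ → ℝ} (hf : Summable f) (k : ℤ) :
    Summable fun n : ℕ => f (k + n) :=
  hf.comp_injective fun m n h => by simpa using h

theorem tsum_int_lower_succ {f : ℤ → ℝ} (hf : Summable f) (k : ℤ) :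
    ∑' n : ℕ, f (k + 1 - n) = f (k + 1) + ∑' n : ℕ, f (k - n) := by
  rw [(hf.int_lower (k + 1)).tsum_eq_zero_add]
  congr 1
  · simp
  · refine tsum_congr fun n => congrArg f ?_
    push_cast
    ring

theorem summable_digit_mul_placeValue_nat (B : ℤ → ℝ) {a : ℤ → ℕ} (ha : LeftVanishing a) :
    Summable fun n : ℕ => (a n : ℝ) * placeValue B n := by
  obtain ⟨N, hN⟩ := ha
  refine summable_of_ne_finset_zero (s := Finset.range N.toNat) fun n hn => ?_
  rw [Finset.mem_range] at hn
  rw [hN n (by omega), Nat.cast_zero, zero_mul]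

theorem negSucc_digit_mul_placeValue (B : ℤ → ℝ) (a : ℤ → ℕ) (n : ℕ) :
    (a (-(n + 1)) : ℝ) * placeValue B (-(n + 1)) =
      (a (-(n + 1)) : ℝ) / ∏ i ∈ Finset.range (n + 1), B (-(i + 1)) := by
  rw [div_eq_mul_inv, ← placeValue_neg_natCast B (n + 1)]
  push_cast
  rfl

theorem isRep_iff_hasSum (B : ℤ → ℝ) (a : ℤ → ℕ) (x : ℝ) :
    IsRep B a x ↔ LeftVanishing a ∧ HasSum (fun n : ℤ => (a n : ℝ) * placeValue B n) x := by
  refine and_congr_right fun ha => ?_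
  have hpos := summable_digit_mul_placeValue_nat B ha
  have key (hs : NegSummable B a) :
      HasSum (fun n : ℤ => (a n : ℝ) * placeValue B n) (valB B a) := by
    refine HasSum.of_nat_of_neg_add_one hpos.hasSum ?_
    simp only [negSucc_digit_mul_placeValue]
    exact hs.hasSum
  constructor
  · rintro ⟨hs, rfl⟩
    exact key hs
  · intro h
    have hs : NegSummable B a := by
      have := h.summable.int_lower (-1)
      refine this.congr fun n => ?_
      rw [← negSucc_digit_mul_placeValue, neg_add']
      ring_nf
    exact ⟨hs, (key hs).unique h⟩

/-- A digit sequence is radix-greatest among those with the same value iff each of its tails is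
smaller than the next place value. -/
theorem forall_isRep_radixLe_iff {B : ℤ → ℝ} (hB : IsCantorBase B) {a : ℤ → ℕ} {x : ℝ}
    (ha : IsRep B a x) :
    (∀ b : ℤ → ℕ, IsRep B b x → radixLe b a) ↔
      ∀ k : ℤ, ∑' n : ℕ, (a (k - n) : ℝ) * placeValue B (k - n) < placeValue B (k + 1) := by
  simp only [isRep_iff_hasSum] at ha ⊢
  have hw := placeValue_pos hB.1
  obtain ⟨⟨N, hN⟩, hax⟩ := ha
  constructor
  · intro hmax k
    by_contra! hk
    obtain ⟨d, hd⟩ := exists_hasSum_digits (fun n : ℕ => hw (k - n))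
      (tendsto_placeValue_sub hB k) (sub_nonneg.2 hk)
    let b : ℤ → ℕ := fun n =>
      if n ≤ k then d (k - n).toNat else a n + if n = k + 1 then 1 else 0
    have hb_low (n : ℕ) : b (k - n) = d n := by simp [b]
    have hb_high (n : ℕ) : b (k + 1 + n) = a (k + 1 + n) + if n = 0 then 1 else 0 := by
      have h : ¬ k + 1 + (n : ℤ) ≤ k := by omega
      simp [b, h]
    have hb_top : b (k + 1) = a (k + 1) + 1 := by simp [b]
    have hb_above (n : ℤ) (hn : k + 1 < n) : b n = a n := by
      have h₁ : ¬ n ≤ k := by omega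
      have h₂ : n ≠ k + 1 := by omega
      simp [b, h₁, h₂]
    have hsum : HasSum (fun n : ℤ => (b n : ℝ) * placeValue B n) x := by
      have hup := (hax.summable.int_upper (k + 1)).hasSum
      have hx := hax.unique (HasSum.of_int_split k (hax.summable.int_lower k).hasSum hup)
      have hup' : HasSum (fun n : ℕ => (b (k + 1 + n) : ℝ) * placeValue B (k + 1 + n)) _ :=
        (hup.add (hasSum_ite_eq 0 (placeValue B (k + 1)))).congr_fun fun n => by
          rw [hb_high]
          rcases eq_or_ne n 0 with rfl | hn
          · simp [add_mul]
          · simp [hn]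
      have hlow : HasSum (fun n : ℕ => (b (k - n) : ℝ) * placeValue B (k - n)) _ :=
        hd.congr_fun fun n => by rw [hb_low]
      convert HasSum.of_int_split (f := fun n : ℤ => (b n : ℝ) * placeValue B n) k hlow hup' using 1
      rw [hx]
      ring
    have hbv : LeftVanishing b := ⟨max N (k + 2), fun n hn => by
      rw [hb_above n (by omega), hN n (by omega)]⟩
    rcases hmax b ⟨hbv, hsum⟩ with h | ⟨i, hi, hlt⟩
    · have := congrFun h (k + 1)
      omega
    · rcases lt_trichotomy i (k + 1) with h | rfl | h
      · have := hi _ h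
        omega
      · omega
      · exact hlt.ne (hb_above i h)
  · rintro hlt b ⟨⟨M, hM⟩, hbx⟩
    by_contra hne
    obtain ⟨hab, hrad⟩ := not_or.1 hne
    obtain ⟨j, hj⟩ := Function.ne_iff.1 hab
    obtain ⟨i, hi, hgreatest⟩ := Int.exists_greatest_of_bdd (P := fun n => b n ≠ a n)
      ⟨max N M, fun n hn => by
        by_contra! h
        exact hn (by rw [hM n (by omega), hN n (by omega)])⟩ ⟨j, hj⟩
    have habove (n : ℤ) (hn : i < n) : b n = a n := by
      by_contra h
      exact (hgreatest n h).not_gt hn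
    have hai : a i < b i := by
      rcases lt_or_gt_of_ne hi with h | h
      · exact (hrad ⟨i, habove, h⟩).elim
      · exact h
    have hupper : ∑' n : ℕ, (b (i + 1 + n) : ℝ) * placeValue B (i + 1 + n) =
        ∑' n : ℕ, (a (i + 1 + n) : ℝ) * placeValue B (i + 1 + n) :=
      tsum_congr fun n => by rw [habove _ (by omega)]
    have hxa := hax.unique (HasSum.of_int_split i (hax.summable.int_lower i).hasSum
      (hax.summable.int_upper (i + 1)).hasSum)
    have hxb := hbx.unique (HasSum.of_int_split i (hbx.summable.int_lower i).hasSum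
      (hbx.summable.int_upper (i + 1)).hasSum)
    have hta := tsum_int_lower_succ hax.summable (i - 1)
    have htb := tsum_int_lower_succ hbx.summable (i - 1)
    have hlti := hlt (i - 1)
    simp only [sub_add_cancel] at hta htb hlti
    have hnonneg : 0 ≤ ∑' n : ℕ, (b (i - 1 - n) : ℝ) * placeValue B (i - 1 - n) :=
      tsum_nonneg fun n => mul_nonneg (Nat.cast_nonneg _) (hw _).le
    have hcast : (a i : ℝ) + 1 ≤ b i := by exact_mod_cast hai
    have := mul_le_mul_of_nonneg_right hcast (hw i).le
    linarith

theorem stmt0 (B : ℤ → ℝ) (hB : IsCantorBase B) (a : ℤ → ℕ)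
    (ha : LeftVanishing a) (hsum : NegSummable B a) :
    (∀ b : ℤ → ℕ, IsRep B b (valB B a) → radixLe b a) ↔
      ((∀ k : ℕ,
          (∑ n ∈ Finset.range (k + 1), (a n : ℝ) * ∏ i ∈ Finset.range n, B i) +
            (∑' n : ℕ, (a (-(n + 1)) : ℝ) / ∏ i ∈ Finset.range (n + 1), B (-(i + 1)))
            < ∏ i ∈ Finset.range (k + 1), B i) ∧
        (∀ K : ℕ,
          (∑' m : ℕ, (a (-((K + 1 + m : ℕ) : ℤ)) : ℝ) /
              ∏ i ∈ Finset.range (K + 1 + m), B (-(i + 1)))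
            < 1 / ∏ i ∈ Finset.range K, B (-(i + 1)))) := by
  have hrep : IsRep B a (valB B a) := ⟨ha, hsum, rfl⟩
  have hS := ((isRep_iff_hasSum B a _).1 hrep).2.summable
  have hneg (K : ℕ) : ∑' m : ℕ, (a (-((K + 1 + m : ℕ) : ℤ)) : ℝ) /
        ∏ i ∈ Finset.range (K + 1 + m), B (-(i + 1)) =
      ∑' n : ℕ, (a (-(K + 1) - n) : ℝ) * placeValue B (-(K + 1) - n) := by
    refine tsum_congr fun n => ?_
    rw [div_eq_mul_inv, ← placeValue_neg_natCast, show -((K + 1 + n : ℕ) : ℤ) = -(K + 1) - n by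
      push_cast; ring]
  have hfrac : ∑' n : ℕ, (a (-(n + 1)) : ℝ) / ∏ i ∈ Finset.range (n + 1), B (-(i + 1)) =
      ∑' n : ℕ, (a (-1 - n) : ℝ) * placeValue B (-1 - n) := by
    refine tsum_congr fun n => ?_
    rw [← negSucc_digit_mul_placeValue, show -((n : ℤ) + 1) = -1 - n by ring]
  have hpos (k : ℕ) : (∑ n ∈ Finset.range k, (a n : ℝ) * ∏ i ∈ Finset.range n, B i) +
        (∑' n : ℕ, (a (-(n + 1)) : ℝ) / ∏ i ∈ Finset.range (n + 1), B (-(i + 1))) =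
      ∑' n : ℕ, (a (k - 1 - n) : ℝ) * placeValue B (k - 1 - n) := by
    induction k with
    | zero => simpa using hfrac
    | succ k ih =>
      have h := tsum_int_lower_succ hS (k - 1)
      simp only [sub_add_cancel] at h
      push_cast
      rw [add_sub_cancel_right, h, ← ih, Finset.sum_range_succ, placeValue_natCast]
      ring
  rw [forall_isRep_radixLe_iff hB hrep]
  simp only [hpos, hneg]
  simp only [one_div, ← placeValue_neg_natCast, ← placeValue_natCast]
  constructor
  · refine fun h => ⟨fun k => ?_, fun K => ?_⟩
    · simpa using h k
    · simpa using h (-(K + 1))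
  · rintro ⟨hp, hn⟩ k
    rcases le_or_gt 0 k with hk | hk
    · lift k to ℕ using hk
      simpa using hp k
    · obtain ⟨K, rfl⟩ : ∃ K : ℕ, k = -(K + 1) := ⟨(-k - 1).toNat, by omega⟩
      simpa using hn K
end

section
/- Let B = (β_n)_{n∈ℤ} be a Cantor real base and for each n ∈ ℤ let 𝐭_n = t_{n,1}t_{n,2}⋯ be the greedy S^n(B)-expansion of 1 and 𝐝_n = d_{n,1}d_{n,2}⋯ be the quasi-greedy S^n(B)-expansion of 1 (assumed to exist). Then for all n ∈ ℤ and all j ≥ 1: t_{n,j+1}t_{n,j+2}⋯ <_lex 𝐝_{n-j} and d_{n,j+1}d_{n,j+2}⋯ ≤_lex 𝐝_{n-j}. -/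
open Filter

/-- `valS B n a = val_{S^n(B)}(0 · a)`, where `a j` is the `(j+1)`-st digit. -/
noncomputable def valS (B : ℤ → ℝ) (n : ℤ) (a : ℕ → ℕ) : ℝ :=
  ∑' j : ℕ, (a j : ℝ) / ∏ i ∈ Finset.range (j + 1), B (n - 1 - i)

/-- Strict lexicographic order on one-sided digit sequences. -/
def lexLt (x y : ℕ → ℕ) : Prop := ∃ j, (∀ i < j, x i = y i) ∧ x j < y j

def lexLe (x y : ℕ → ℕ) : Prop := x = y ∨ lexLt x y

/-- The sequence ends in a tail of zeros. -/
def EvZero (x : ℕ → ℕ) : Prop := ∃ N, ∀ j ≥ N, x j = 0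

/-- `t` is the greedy `S^n(B)`-expansion of `1`: it is lexicographically greatest among
sequences of nonnegative integers with value `1`. -/
def IsGreedyOne (B : ℤ → ℝ) (n : ℤ) (t : ℕ → ℕ) : Prop :=
  valS B n t = 1 ∧ ∀ b : ℕ → ℕ, valS B n b = 1 → lexLe b t

/-- `d` is the quasi-greedy `S^n(B)`-expansion of `1`: it is lexicographically greatest among
sequences of nonnegative integers not ending in a tail of zeros with value `1`. -/
def IsQuasiGreedyOne (B : ℤ → ℝ) (n : ℤ) (d : ℕ → ℕ) : Prop :=
  ¬ EvZero d ∧ valS B n d = 1 ∧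
    ∀ b : ℕ → ℕ, ¬ EvZero b → valS B n b = 1 → lexLe b d

/-- The product `β_{n-1} β_{n-2} ⋯ β_{n-k}`. -/
noncomputable def baseProd (B : ℤ → ℝ) (n : ℤ) (k : ℕ) : ℝ :=
  ∏ i ∈ Finset.range k, B (n - 1 - i)

theorem baseProd_pos {B : ℤ → ℝ} (hB : ∀ n, 1 < B n) (n : ℤ) (k : ℕ) : 0 < baseProd B n k :=
  Finset.prod_pos fun _ _ => one_pos.trans (hB _)

theorem baseProd_succ (B : ℤ → ℝ) (n : ℤ) (k : ℕ) :
    baseProd B n (k + 1) = baseProd B n k * B (n - 1 - k) :=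
  Finset.prod_range_succ _ _

theorem baseProd_add (B : ℤ → ℝ) (n : ℤ) (j k : ℕ) :
    baseProd B n (j + k) = baseProd B n j * baseProd B (n - j) k := by
  unfold baseProd
  rw [Finset.prod_range_add]
  congr 1
  refine Finset.prod_congr rfl fun i _ => ?_
  congr 1
  push_cast
  ring

theorem tendsto_baseProd {B : ℤ → ℝ} (hB : IsCantorBase B) (n : ℤ) :
    Tendsto (baseProd B n) atTop atTop := by
  have shift : ∀ m : ℤ, baseProd B m =
      fun k : ℕ => (B m)⁻¹ * baseProd B (m + 1) (k + 1) := by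
    intro m
    funext k
    have hm : B m ≠ 0 := (one_pos.trans (hB.1 m)).ne'
    rw [add_comm k 1, baseProd_add]
    have h1 : baseProd B (m + 1) 1 = B m := by simp [baseProd]
    rw [h1, Nat.cast_one, add_sub_cancel_right, inv_mul_cancel_left₀ hm]
  induction n using Int.induction_on with
  | zero =>
    refine hB.2.2.congr fun k => Finset.prod_congr rfl fun i _ => ?_
    congr 1
    ring
  | succ m ih =>
    have hm := one_pos.trans (hB.1 (m : ℤ))
    refine (tendsto_add_atTop_iff_nat 1).1 ?_
    refine (ih.const_mul_atTop hm).congr fun k => ?_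
    rw [shift m, mul_inv_cancel_left₀ hm.ne']
  | pred m ih =>
    rw [shift, sub_add_cancel]
    exact ((tendsto_add_atTop_iff_nat 1).2 ih).const_mul_atTop
      (inv_pos.2 (one_pos.trans (hB.1 _)))

/-- The sequence `a` has a convergent `S^n(B)`-value, equal to `x`. -/
def HasVal (B : ℤ → ℝ) (n : ℤ) (a : ℕ → ℕ) (x : ℝ) : Prop :=
  HasSum (fun j => (a j : ℝ) / baseProd B n (j + 1)) x

theorem HasVal.valS_eq {B : ℤ → ℝ} {n : ℤ} {a : ℕ → ℕ} {x : ℝ} (h : HasVal B n a x) :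
    valS B n a = x :=
  h.tsum_eq

theorem hasVal_of_valS_eq {B : ℤ → ℝ} {n : ℤ} {a : ℕ → ℕ} {x : ℝ} (hx : x ≠ 0)
    (h : valS B n a = x) : HasVal B n a x := by
  by_cases hs : Summable fun j => (a j : ℝ) / baseProd B n (j + 1)
  · exact h ▸ hs.hasSum
  · exact absurd (h.symm.trans (tsum_eq_zero_of_not_summable hs)) hx

/-- The value of the first `k` digits of `a`. -/
noncomputable def prefixVal (B : ℤ → ℝ) (n : ℤ) (a : ℕ → ℕ) (k : ℕ) : ℝ :=
  ∑ i ∈ Finset.range k, (a i : ℝ) / baseProd B n (i + 1)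

theorem prefixVal_succ (B : ℤ → ℝ) (n : ℤ) (a : ℕ → ℕ) (k : ℕ) :
    prefixVal B n a (k + 1) = prefixVal B n a k + a k / baseProd B n (k + 1) :=
  Finset.sum_range_succ _ _

theorem prefixVal_congr (B : ℤ → ℝ) (n : ℤ) {a b : ℕ → ℕ} {k : ℕ} (h : ∀ i < k, a i = b i) :
    prefixVal B n a k = prefixVal B n b k :=
  Finset.sum_congr rfl fun i hi => by rw [h i (Finset.mem_range.1 hi)]

theorem HasVal.prefixVal_le {B : ℤ → ℝ} (hB : ∀ n, 1 < B n) {n : ℤ} {a : ℕ → ℕ} {x : ℝ}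
    (h : HasVal B n a x) (k : ℕ) : prefixVal B n a k ≤ x :=
  sum_le_hasSum _ (fun i _ => div_nonneg (Nat.cast_nonneg _) (baseProd_pos hB n (i + 1)).le) h

theorem hasVal_iff_shift {B : ℤ → ℝ} (hB : ∀ n, 1 < B n) (n : ℤ) (a : ℕ → ℕ) (k : ℕ) (x : ℝ) :
    HasVal B n a x ↔
      HasVal B (n - k) (fun m => a (m + k)) (baseProd B n k * (x - prefixVal B n a k)) := by
  have hp := (baseProd_pos hB n k).ne'
  unfold HasVal prefixVal
  rw [← hasSum_nat_add_iff' k, ← hasSum_mul_left_iff hp]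
  refine iff_of_eq (congrArg (fun f => HasSum f _) (funext fun m => ?_))
  rw [show m + k + 1 = k + (m + 1) by ring, baseProd_add, ← mul_div_assoc, mul_div_mul_left _ _ hp]

/-- Remainders of the quasi-greedy algorithm. -/
noncomputable def quasiRem (B : ℤ → ℝ) (n : ℤ) (r : ℝ) : ℕ → ℝ
  | 0 => r
  | k + 1 => B (n - 1 - k) * quasiRem B n r k - ((⌈B (n - 1 - k) * quasiRem B n r k⌉₊ - 1 : ℕ) : ℝ)

/-- Digits of the quasi-greedy algorithm. -/
noncomputable def quasiDigit (B : ℤ → ℝ) (n : ℤ) (r : ℝ) (k : ℕ) : ℕ :=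
  ⌈B (n - 1 - k) * quasiRem B n r k⌉₊ - 1

theorem quasiRem_succ_mem {B : ℤ → ℝ} {n : ℤ} {r : ℝ} {k : ℕ}
    (h : 0 < B (n - 1 - k) * quasiRem B n r k) : quasiRem B n r (k + 1) ∈ Set.Ioc (0 : ℝ) 1 := by
  have h1 : 1 ≤ ⌈B (n - 1 - k) * quasiRem B n r k⌉₊ := Nat.ceil_pos.2 h
  have h2 := Nat.le_ceil (B (n - 1 - k) * quasiRem B n r k)
  have h3 := Nat.ceil_lt_add_one h.le
  simp only [quasiRem, Nat.cast_sub h1, Nat.cast_one, Set.mem_Ioc]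
  constructor <;> linarith

theorem quasiRem_pos {B : ℤ → ℝ} (hB : ∀ n, 1 < B n) (n : ℤ) {r : ℝ} (hr : 0 < r) (k : ℕ) :
    0 < quasiRem B n r k := by
  induction k with
  | zero => exact hr
  | succ k ih => exact (quasiRem_succ_mem (mul_pos (one_pos.trans (hB _)) ih)).1

theorem quasiRem_succ_le_one {B : ℤ → ℝ} (hB : ∀ n, 1 < B n) (n : ℤ) {r : ℝ} (hr : 0 < r) (k : ℕ) :
    quasiRem B n r (k + 1) ≤ 1 :=
  (quasiRem_succ_mem (mul_pos (one_pos.trans (hB _)) (quasiRem_pos hB n hr k))).2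

theorem prefixVal_quasiDigit {B : ℤ → ℝ} (hB : ∀ n, 1 < B n) (n : ℤ) (r : ℝ) (k : ℕ) :
    prefixVal B n (quasiDigit B n r) k = r - quasiRem B n r k / baseProd B n k := by
  induction k with
  | zero => simp [prefixVal, quasiRem, baseProd]
  | succ k ih =>
    have hp := (baseProd_pos hB n k).ne'
    have hb : B (n - 1 - k) ≠ 0 := (one_pos.trans (hB _)).ne'
    have hrem : quasiRem B n r (k + 1) =
        B (n - 1 - k) * quasiRem B n r k - quasiDigit B n r k := rfl
    rw [prefixVal_succ, ih, hrem, baseProd_succ]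
    field_simp
    ring

theorem tendsto_quasiRem_div {B : ℤ → ℝ} (hB : IsCantorBase B) (n : ℤ) {r : ℝ} (hr : 0 < r) :
    Tendsto (fun k => quasiRem B n r k / baseProd B n k) atTop (nhds 0) := by
  rw [← tendsto_add_atTop_iff_nat 1]
  have hlim := ((tendsto_add_atTop_iff_nat 1).2 (tendsto_baseProd hB n)).inv_tendsto_atTop
  refine squeeze_zero (fun k => ?_) (fun k => ?_) hlim
  · exact div_nonneg (quasiRem_pos hB.1 n hr _).le (baseProd_pos hB.1 n _).le
  · rw [div_eq_mul_inv]
    exact mul_le_of_le_one_left (inv_nonneg.2 (baseProd_pos hB.1 n _).le)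
      (quasiRem_succ_le_one hB.1 n hr k)

theorem hasVal_quasiDigit {B : ℤ → ℝ} (hB : IsCantorBase B) (n : ℤ) {r : ℝ} (hr : 0 < r) :
    HasVal B n (quasiDigit B n r) r := by
  refine (hasSum_iff_tendsto_nat_of_nonneg
    (fun i => div_nonneg (Nat.cast_nonneg _) (baseProd_pos hB.1 n _).le) r).2 ?_
  have h := (tendsto_quasiRem_div hB n hr).const_sub r
  rw [sub_zero] at h
  exact h.congr fun k => (prefixVal_quasiDigit hB.1 n r k).symm

theorem HasVal.eq_prefixVal {B : ℤ → ℝ} {n : ℤ} {a : ℕ → ℕ} {x : ℝ} (h : HasVal B n a x) {N : ℕ}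
    (hN : ∀ j ≥ N, a j = 0) : x = prefixVal B n a N := by
  refine h.unique (hasSum_sum_of_ne_finset_zero fun j hj => ?_)
  rw [hN j (by simpa using hj), Nat.cast_zero, zero_div]

theorem not_evZero_quasiDigit {B : ℤ → ℝ} (hB : IsCantorBase B) (n : ℤ) {r : ℝ} (hr : 0 < r) :
    ¬ EvZero (quasiDigit B n r) := by
  rintro ⟨N, hN⟩
  have h := (hasVal_quasiDigit hB n hr).eq_prefixVal hN
  rw [prefixVal_quasiDigit hB.1] at h
  have := div_pos (quasiRem_pos hB.1 n hr N) (baseProd_pos hB.1 n N)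
  linarith

theorem lexLt.not_lexLe {x y : ℕ → ℕ} (h : lexLt x y) : ¬ lexLe y x := by
  obtain ⟨j, hj, hlt⟩ := h
  rintro (rfl | ⟨k, hk, hlt'⟩)
  · exact lt_irrefl _ hlt
  · rcases lt_trichotomy j k with h | rfl | h
    · exact hlt.ne' (hk j h)
    · exact lt_asymm hlt hlt'
    · exact hlt'.ne' (hj k h)

theorem lexLt_or_eq_or_lexLt (x y : ℕ → ℕ) : lexLt x y ∨ x = y ∨ lexLt y x := by
  classical
  by_cases h : ∃ j, x j ≠ y j
  · have hmin : ∀ i < Nat.find h, x i = y i := fun i hi => not_not.1 (Nat.find_min h hi)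
    rcases (Nat.find_spec h).lt_or_gt with hlt | hlt
    · exact .inl ⟨_, hmin, hlt⟩
    · exact .inr (.inr ⟨_, fun i hi => (hmin i hi).symm, hlt⟩)
  · exact .inr (.inl (funext fun j => not_not.1 fun hj => h ⟨j, hj⟩))

/-- The sequence `u₀ ⋯ u_{k-1} v a₀ a₁ ⋯`. -/
def splice (u : ℕ → ℕ) (k v : ℕ) (a : ℕ → ℕ) (i : ℕ) : ℕ :=
  if i < k then u i else if i = k then v else a (i - (k + 1))

theorem splice_of_lt {u a : ℕ → ℕ} {k v i : ℕ} (h : i < k) : splice u k v a i = u i := if_pos h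

theorem splice_self (u a : ℕ → ℕ) (k v : ℕ) : splice u k v a k = v := by simp [splice]

theorem splice_add (u a : ℕ → ℕ) (k v m : ℕ) : splice u k v a (m + (k + 1)) = a m := by
  rw [splice, if_neg (by omega), if_neg (by omega), Nat.add_sub_cancel]

theorem lexLt_splice {u : ℕ → ℕ} {k v : ℕ} (h : u k < v) (a : ℕ → ℕ) : lexLt u (splice u k v a) :=
  ⟨k, fun _ hi => (splice_of_lt hi).symm, by rwa [splice_self]⟩

theorem valS_splice {B : ℤ → ℝ} (hB : ∀ n, 1 < B n) {n : ℤ} {u a : ℕ → ℕ} {k v : ℕ} {x : ℝ}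
    (h : HasVal B (n - (k + 1 : ℕ)) a
      (baseProd B n (k + 1) * (x - (prefixVal B n u k + v / baseProd B n (k + 1))))) :
    valS B n (splice u k v a) = x := by
  refine HasVal.valS_eq ((hasVal_iff_shift hB n _ (k + 1) x).2 ?_)
  rw [prefixVal_succ, splice_self, prefixVal_congr B n fun i hi => splice_of_lt hi]
  simpa only [splice_add] using h

theorem exists_lexLt_of_lt_one {B : ℤ → ℝ} (hB : IsCantorBase B) {n : ℤ} {u : ℕ → ℕ} {k v : ℕ}
    (hv : u k < v) (h : prefixVal B n u k + v / baseProd B n (k + 1) < 1) :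
    ∃ c, lexLt u c ∧ ¬ EvZero c ∧ valS B n c = 1 := by
  have hr := mul_pos (baseProd_pos hB.1 n (k + 1)) (sub_pos.2 h)
  refine ⟨_, lexLt_splice hv _, ?_, valS_splice hB.1 (hasVal_quasiDigit hB _ hr)⟩
  rintro ⟨N, hN⟩
  refine not_evZero_quasiDigit hB (n - (k + 1 : ℕ)) hr ⟨N, fun j hj => ?_⟩
  rw [← hN (j + (k + 1)) (by omega), splice_add]

theorem exists_lexLt_of_le_one {B : ℤ → ℝ} (hB : IsCantorBase B) {n : ℤ} {u : ℕ → ℕ} {k v : ℕ}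
    (hv : u k < v) (h : prefixVal B n u k + v / baseProd B n (k + 1) ≤ 1) :
    ∃ c, lexLt u c ∧ valS B n c = 1 := by
  rcases h.lt_or_eq with h | h
  · obtain ⟨c, hc, -, hval⟩ := exists_lexLt_of_lt_one hB hv h
    exact ⟨c, hc, hval⟩
  · refine ⟨_, lexLt_splice hv fun _ => 0, valS_splice hB.1 ?_⟩
    simp [HasVal, h, hasSum_zero]

theorem IsQuasiGreedyOne.lexLt_of_hasVal_lt_one {B : ℤ → ℝ} (hB : IsCantorBase B) {n : ℤ}
    {b d : ℕ → ℕ} (hd : IsQuasiGreedyOne B n d) {x : ℝ} (hb : HasVal B n b x) (hx : x < 1) :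
    lexLt b d := by
  rcases lexLt_or_eq_or_lexLt b d with h | rfl | ⟨k, hk, hlt⟩
  · exact h
  · exact absurd (hb.valS_eq.symm.trans hd.2.1) hx.ne
  · have hle := hb.prefixVal_le hB.1 (k + 1)
    rw [prefixVal_succ, ← prefixVal_congr B n hk] at hle
    obtain ⟨c, hc, hc0, hval⟩ := exists_lexLt_of_lt_one hB hlt (hle.trans_lt hx)
    exact absurd (hd.2.2 c hc0 hval) hc.not_lexLe

/-- Incrementing the digit `u k` gives a prefix whose value exceeds `1` by a multiple of `1 - x`,
where `x` is the value of the tail of `u` after index `k`. -/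
theorem prefixVal_add_incr {B : ℤ → ℝ} (hB : ∀ n, 1 < B n) (n : ℤ) (u : ℕ → ℕ) (k : ℕ) :
    prefixVal B n u k + (u k + 1 : ℕ) / baseProd B n (k + 1) - 1 =
      (1 - baseProd B n (k + 1) * (1 - prefixVal B n u (k + 1))) / baseProd B n (k + 1) := by
  have hp := (baseProd_pos hB n (k + 1)).ne'
  rw [prefixVal_succ]
  field_simp
  push_cast
  ring

theorem IsGreedyOne.tail_lt_one {B : ℤ → ℝ} (hB : IsCantorBase B) {n : ℤ} {t : ℕ → ℕ}
    (ht : IsGreedyOne B n t) (k : ℕ) :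
    baseProd B n (k + 1) * (1 - prefixVal B n t (k + 1)) < 1 := by
  by_contra! h
  obtain ⟨c, hc, hval⟩ := exists_lexLt_of_le_one hB (n := n) (Nat.lt_succ_self (t k)) <| by
    rw [← sub_nonpos, prefixVal_add_incr hB.1]
    exact div_nonpos_of_nonpos_of_nonneg (sub_nonpos.2 h) (baseProd_pos hB.1 n _).le
  exact hc.not_lexLe (ht.2 c hval)

theorem IsQuasiGreedyOne.tail_le_one {B : ℤ → ℝ} (hB : IsCantorBase B) {n : ℤ} {d : ℕ → ℕ}
    (hd : IsQuasiGreedyOne B n d) (k : ℕ) :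
    baseProd B n (k + 1) * (1 - prefixVal B n d (k + 1)) ≤ 1 := by
  by_contra! h
  obtain ⟨c, hc, hc0, hval⟩ := exists_lexLt_of_lt_one hB (n := n) (Nat.lt_succ_self (d k)) <| by
    rw [← sub_neg, prefixVal_add_incr hB.1]
    exact div_neg_of_neg_of_pos (sub_neg.2 h) (baseProd_pos hB.1 n _)
  exact hc.not_lexLe (hd.2.2 c hc0 hval)

theorem stmt1 (B : ℤ → ℝ) (hB : IsCantorBase B)
    (t d : ℤ → ℕ → ℕ)
    (ht : ∀ n : ℤ, IsGreedyOne B n (t n))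
    (hd : ∀ n : ℤ, IsQuasiGreedyOne B n (d n)) :
    ∀ n : ℤ, ∀ j : ℕ, 1 ≤ j →
      lexLt (fun m => t n (m + j)) (d (n - j)) ∧
      lexLe (fun m => d n (m + j)) (d (n - j)) := by
  intro n j hj
  obtain ⟨k, rfl⟩ : ∃ k, j = k + 1 := ⟨j - 1, by omega⟩
  have hT := (hasVal_iff_shift hB.1 n _ (k + 1) 1).1 (hasVal_of_valS_eq one_ne_zero (ht n).1)
  have hD := (hasVal_iff_shift hB.1 n _ (k + 1) 1).1 (hasVal_of_valS_eq one_ne_zero (hd n).2.1)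
  refine ⟨(hd _).lexLt_of_hasVal_lt_one hB hT ((ht n).tail_lt_one hB k), ?_⟩
  rcases ((hd n).tail_le_one hB k).lt_or_eq with h | h
  · exact .inr ((hd _).lexLt_of_hasVal_lt_one hB hD h)
  · refine (hd _).2.2 _ ?_ (hD.valS_eq.trans h)
    rintro ⟨N, hN⟩
    refine (hd n).1 ⟨N + (k + 1), fun i hi => ?_⟩
    have hi0 : d n (i - (k + 1) + (k + 1)) = 0 := hN _ (by omega)
    rwa [Nat.sub_add_cancel (by omega)] at hi0
end

section
/- Let B = (β_n)_{n∈ℤ} be a Cantor real base and for each n ∈ ℤ let 𝐚_n = a_{n,1}a_{n,2}⋯ be a sequence of nonnegative integers with val_{S^n(B)}(0·𝐚_n) = 1. Assume that for every n ∈ ℤ: if 𝐚_n ends in a tail of zeros then a_{n,j+1}a_{n,j+2}⋯ <_lex 𝐚_{n-j} for all j ≥ 1, and if 𝐚_n does not end in a tail of zeros then a_{n,j+1}a_{n,j+2}⋯ ≤_lex 𝐚_{n-j} for all j ≥ 1. Then for every n ∈ ℤ such that 𝐚_n ends in a tail of zeros, 𝐚_n is the lexicographically greatest sequence 𝐛 of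 nonnegative integers with val_{S^n(B)}(0·𝐛) = 1 (i.e., 𝐚_n = 𝐭_n), and for every n ∈ ℤ such that 𝐚_n does not end in a tail of zeros, 𝐚_n is the lexicographically greatest sequence 𝐛 of nonnegative integers not ending in a tail of zeros with val_{S^n(B)}(0·𝐛) = 1 (i.e., 𝐚_n = 𝐝_n). -/
open Filter

/-- The weight `β_{n-1} ⋯ β_{n-j}` dividing the `j`-th digit. -/
noncomputable def baseWeight (B : ℤ → ℝ) (n : ℤ) (j : ℕ) : ℝ :=
  ∏ i ∈ Finset.range j, B (n - 1 - i)

/-- The contribution of the `j`-th digit to `valS B n a`. -/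
noncomputable def digitTerm (B : ℤ → ℝ) (n : ℤ) (a : ℕ → ℕ) (j : ℕ) : ℝ :=
  (a j : ℝ) / baseWeight B n (j + 1)

/-- The sequence with its first `j` digits removed. -/
def dropDigits (j : ℕ) (a : ℕ → ℕ) : ℕ → ℕ := fun m => a (m + j)

theorem valS_eq_tsum_digitTerm (B : ℤ → ℝ) (n : ℤ) (a : ℕ → ℕ) :
    valS B n a = ∑' j, digitTerm B n a j := rfl

theorem baseWeight_add (B : ℤ → ℝ) (n : ℤ) (j k : ℕ) :
    baseWeight B n (j + k) = baseWeight B n j * baseWeight B (n - j) k := by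
  unfold baseWeight
  rw [Finset.prod_range_add]
  congr 1
  refine Finset.prod_congr rfl fun i _ => ?_
  congr 1
  push_cast
  ring

theorem dropDigits_dropDigits (j k : ℕ) (a : ℕ → ℕ) :
    dropDigits k (dropDigits j a) = dropDigits (j + k) a := by
  funext m
  simp only [dropDigits]
  congr 1
  omega

theorem evZero_of_evZero_dropDigits {k : ℕ} {a : ℕ → ℕ} (h : EvZero (dropDigits k a)) :
    EvZero a := by
  obtain ⟨N, hN⟩ := h
  refine ⟨N + k, fun j hj => ?_⟩
  have := hN (j - k) (by omega)
  rwa [dropDigits, Nat.sub_add_cancel (by omega)] at this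

theorem lexLt_of_not_lexLe {x y : ℕ → ℕ} (h : ¬ lexLe x y) : lexLt y x := by
  classical
  simp only [lexLe, lexLt, not_or, not_exists, not_and, not_lt] at h
  obtain ⟨hne, hle⟩ := h
  have hex : ∃ j, x j ≠ y j := Function.ne_iff.mp hne
  have heq : ∀ i < Nat.find hex, x i = y i := fun i hi => not_not.mp (Nat.find_min hex hi)
  exact ⟨Nat.find hex, fun i hi => (heq i hi).symm,
    lt_of_le_of_ne (hle _ heq) (Nat.find_spec hex).symm⟩

section PositiveBase

variable {B : ℤ → ℝ}

theorem baseWeight_pos (hB : ∀ n, 0 < B n) (n : ℤ) (j : ℕ) : 0 < baseWeight B n j :=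
  Finset.prod_pos fun _ _ => hB _

theorem digitTerm_nonneg (hB : ∀ n, 0 < B n) (n : ℤ) (a : ℕ → ℕ) (j : ℕ) :
    0 ≤ digitTerm B n a j :=
  div_nonneg (Nat.cast_nonneg _) (baseWeight_pos hB n _).le

theorem valS_nonneg (hB : ∀ n, 0 < B n) (n : ℤ) (a : ℕ → ℕ) : 0 ≤ valS B n a :=
  tsum_nonneg fun j => digitTerm_nonneg hB n a j

theorem summable_digitTerm {n : ℤ} {a : ℕ → ℕ} (h : valS B n a = 1) :
    Summable (digitTerm B n a) := by
  by_contra hs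
  rw [valS_eq_tsum_digitTerm, tsum_eq_zero_of_not_summable hs] at h
  exact zero_ne_one h

theorem digitTerm_dropDigits (hB : ∀ n, 0 < B n) (n : ℤ) (a : ℕ → ℕ) (j m : ℕ) :
    digitTerm B (n - j) (dropDigits j a) m = baseWeight B n j * digitTerm B n a (m + j) := by
  have h1 := (baseWeight_pos hB n j).ne'
  have h2 := (baseWeight_pos hB (n - j) (m + 1)).ne'
  rw [digitTerm, digitTerm, dropDigits, show m + j + 1 = j + (m + 1) by omega,
    baseWeight_add B n j (m + 1)]
  field_simp

theorem summable_digitTerm_dropDigits (hB : ∀ n, 0 < B n) {n : ℤ} {a : ℕ → ℕ}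
    (h : Summable (digitTerm B n a)) (j : ℕ) :
    Summable (digitTerm B (n - j) (dropDigits j a)) := by
  rw [funext (digitTerm_dropDigits hB n a j)]
  exact ((summable_nat_add_iff j).mpr h).mul_left _

theorem valS_dropDigits (hB : ∀ n, 0 < B n) (n : ℤ) (a : ℕ → ℕ) (j : ℕ) :
    valS B (n - j) (dropDigits j a) = baseWeight B n j * ∑' m, digitTerm B n a (m + j) := by
  rw [valS_eq_tsum_digitTerm, funext (digitTerm_dropDigits hB n a j), tsum_mul_left]

theorem valS_eq_sum_add (hB : ∀ n, 0 < B n) {n : ℤ} {a : ℕ → ℕ}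
    (h : Summable (digitTerm B n a)) (j : ℕ) :
    valS B n a = ∑ i ∈ Finset.range j, digitTerm B n a i +
      valS B (n - j) (dropDigits j a) / baseWeight B n j := by
  rw [valS_dropDigits hB, mul_div_cancel_left₀ _ (baseWeight_pos hB n j).ne',
    h.sum_add_tsum_nat_add, valS_eq_tsum_digitTerm]

theorem valS_pos (hB : ∀ n, 0 < B n) {n : ℤ} {a : ℕ → ℕ}
    (h : Summable (digitTerm B n a)) (ha : ¬ EvZero a) : 0 < valS B n a := by
  have hex : ∃ j, a j ≠ 0 := by
    by_contra! hz
    exact ha ⟨0, fun j _ => hz j⟩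
  obtain ⟨j, hj⟩ := hex
  exact h.tsum_pos (digitTerm_nonneg hB n a) j
    (div_pos (Nat.cast_pos.mpr (Nat.pos_of_ne_zero hj)) (baseWeight_pos hB n _))

/-- Comparison of values when `u` and `v` first differ at `k`, with the smaller digit in `u`. -/
theorem valS_add_le_of_first_diff (hB : ∀ n, 0 < B n) {n : ℤ} {u v : ℕ → ℕ}
    (hu : Summable (digitTerm B n u)) (hv : Summable (digitTerm B n v)) {k : ℕ}
    (heq : ∀ i < k, u i = v i) (hlt : u k < v k) :
    valS B n u + valS B (n - (k + 1 : ℕ)) (dropDigits (k + 1) v) / baseWeight B n (k + 1) ≤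
      valS B n v +
        (valS B (n - (k + 1 : ℕ)) (dropDigits (k + 1) u) - 1) / baseWeight B n (k + 1) := by
  have hw := baseWeight_pos hB n (k + 1)
  have hsum : ∑ i ∈ Finset.range k, digitTerm B n u i = ∑ i ∈ Finset.range k, digitTerm B n v i :=
    Finset.sum_congr rfl fun i hi => by
      rw [digitTerm, digitTerm, heq i (Finset.mem_range.mp hi)]
  have hdigit : digitTerm B n u k + 1 / baseWeight B n (k + 1) ≤ digitTerm B n v k := by
    rw [digitTerm, digitTerm, ← add_div]
    gcongr
    exact_mod_cast hlt
  rw [valS_eq_sum_add hB hu (k + 1), valS_eq_sum_add hB hv (k + 1), Finset.sum_range_succ,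
    Finset.sum_range_succ, hsum, sub_div]
  linarith

/-- The scaled excess of the value of the `j`-th tail over `1`. -/
noncomputable def tailExcess (B : ℤ → ℝ) (n : ℤ) (a : ℕ → ℕ) (j : ℕ) : ℝ :=
  (valS B (n - j) (dropDigits j a) - 1) / baseWeight B n j

theorem tailExcess_eq (hB : ∀ n, 0 < B n) (n : ℤ) (a : ℕ → ℕ) (j : ℕ) :
    tailExcess B n a j = ∑' m, digitTerm B n a (m + j) - 1 / baseWeight B n j := by
  rw [tailExcess, valS_dropDigits hB, sub_div,
    mul_div_cancel_left₀ _ (baseWeight_pos hB n j).ne']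

theorem exists_tailExcess_le_of_lexLt (hB : ∀ n, 0 < B n) {n : ℤ} {a v : ℕ → ℕ} {j : ℕ}
    (ha : Summable (digitTerm B n a)) (hv : valS B (n - j) v = 1)
    (h : lexLt (dropDigits j a) v) :
    ∃ j' > j, tailExcess B n a j ≤ tailExcess B n a j' := by
  obtain ⟨k, heq, hlt⟩ := h
  refine ⟨j + (k + 1), by omega, ?_⟩
  have hw := baseWeight_pos hB n j
  have hw' := baseWeight_pos hB (n - j) (k + 1)
  have key := valS_add_le_of_first_diff hB (summable_digitTerm_dropDigits hB ha j)
    (summable_digitTerm hv) heq hlt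
  have hnn := div_nonneg
    (valS_nonneg hB (n - j - (k + 1 : ℕ)) (dropDigits (k + 1) v)) hw'.le
  rw [hv, dropDigits_dropDigits] at key
  rw [tailExcess, tailExcess, baseWeight_add, mul_comm, ← div_div,
    show n - ((j + (k + 1) : ℕ) : ℤ) = n - j - (k + 1 : ℕ) by push_cast; ring]
  gcongr
  linarith

theorem exists_ge_of_exists_gt {D : ℕ → ℝ} {c : ℝ} {j : ℕ}
    (h : ∀ i ≥ j, c ≤ D i → ∃ i' > i, D i ≤ D i') (hj : c ≤ D j) (N : ℕ) :
    ∃ i ≥ N, j ≤ i ∧ c ≤ D i := by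
  induction N with
  | zero => exact ⟨j, Nat.zero_le _, le_rfl, hj⟩
  | succ N ih =>
    obtain ⟨i, hN, hji, hc⟩ := ih
    obtain ⟨i', hi', hle⟩ := h i hji hc
    exact ⟨i', by omega, by omega, hc.trans hle⟩

theorem valS_dropDigits_lt_one (hB : ∀ n, 0 < B n) {a : ℤ → ℕ → ℕ}
    (hval : ∀ n, valS B n (a n) = 1) {n : ℤ} (hz : EvZero (a n))
    (hlex : ∀ j : ℕ, 1 ≤ j → lexLt (dropDigits j (a n)) (a (n - j))) {j : ℕ} (hj : 1 ≤ j) :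
    valS B (n - j) (dropDigits j (a n)) < 1 := by
  by_contra! hge
  obtain ⟨N, hN⟩ := hz
  obtain ⟨i, hi, -, hc⟩ := exists_ge_of_exists_gt (D := tailExcess B n (a n)) (c := 0) (j := j)
    (fun i hi _ => exists_tailExcess_le_of_lexLt hB (summable_digitTerm (hval n)) (hval _)
      (hlex i (hj.trans hi)))
    (div_nonneg (sub_nonneg.mpr hge) (baseWeight_pos hB n j).le) N
  have h0 : ∀ m, digitTerm B n (a n) (m + i) = 0 := fun m => by
    rw [digitTerm, hN _ (by omega), Nat.cast_zero, zero_div]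
  rw [tailExcess_eq hB, tsum_congr h0, tsum_zero] at hc
  have := one_div_pos.mpr (baseWeight_pos hB n i)
  linarith

theorem valS_dropDigits_le_one (hB : ∀ n, 0 < B n) {a : ℤ → ℕ → ℕ}
    (hval : ∀ n, valS B n (a n) = 1) {n : ℤ}
    (hlex : ∀ j : ℕ, 1 ≤ j → lexLe (dropDigits j (a n)) (a (n - j))) {j : ℕ} (hj : 1 ≤ j) :
    valS B (n - j) (dropDigits j (a n)) ≤ 1 := by
  by_contra! hgt
  have hpos : 0 < tailExcess B n (a n) j :=
    div_pos (sub_pos.mpr hgt) (baseWeight_pos hB n j)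
  have hstep : ∀ i ≥ j, tailExcess B n (a n) j ≤ tailExcess B n (a n) i →
      ∃ i' > i, tailExcess B n (a n) i ≤ tailExcess B n (a n) i' := fun i hi hc => by
    rcases hlex i (hj.trans hi) with heq | hlt
    · have h0 : tailExcess B n (a n) i = 0 := by
        rw [tailExcess, heq, hval, sub_self, zero_div]
      linarith
    · exact exists_tailExcess_le_of_lexLt hB (summable_digitTerm (hval n)) (hval _) hlt
  obtain ⟨N, hN⟩ := eventually_atTop.mp
    ((tendsto_sum_nat_add (digitTerm B n (a n))).eventually_lt_const hpos)
  obtain ⟨i, hi, -, hc⟩ := exists_ge_of_exists_gt hstep le_rfl N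
  have htail := hN i hi
  have hw := one_div_pos.mpr (baseWeight_pos hB n i)
  rw [tailExcess_eq hB n (a n) i] at hc
  linarith

end PositiveBase

theorem stmt2 (B : ℤ → ℝ) (hB : IsCantorBase B) (a : ℤ → ℕ → ℕ)
    (hval : ∀ n : ℤ, valS B n (a n) = 1)
    (hcond : ∀ n : ℤ,
      (EvZero (a n) → ∀ j : ℕ, 1 ≤ j → lexLt (fun m => a n (m + j)) (a (n - j))) ∧
      (¬ EvZero (a n) → ∀ j : ℕ, 1 ≤ j → lexLe (fun m => a n (m + j)) (a (n - j)))) :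
    ∀ n : ℤ,
      (EvZero (a n) → IsGreedyOne B n (a n)) ∧
      (¬ EvZero (a n) → IsQuasiGreedyOne B n (a n)) := by
  have hpos : ∀ n, 0 < B n := fun n => zero_lt_one.trans (hB.1 n)
  intro n
  refine ⟨fun hz => ⟨hval n, fun b hb => ?_⟩, fun hz => ⟨hz, hval n, fun b hbz hb => ?_⟩⟩
  all_goals
    by_contra hnot
    obtain ⟨k, heq, hlt⟩ := lexLt_of_not_lexLe hnot
    have hw := baseWeight_pos hpos n (k + 1)
    have key := valS_add_le_of_first_diff hpos (summable_digitTerm (hval n))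
      (summable_digitTerm hb) heq hlt
    rw [hval n, hb, add_le_add_iff_left, div_le_div_iff_of_pos_right hw] at key
  · have hlt1 := valS_dropDigits_lt_one hpos hval hz ((hcond n).1 hz) (Nat.le_add_left 1 k)
    have hnn := valS_nonneg hpos (n - (k + 1 : ℕ)) (dropDigits (k + 1) b)
    linarith
  · have hle1 := valS_dropDigits_le_one hpos hval ((hcond n).2 hz) (Nat.le_add_left 1 k)
    have hbpos := valS_pos hpos
      (summable_digitTerm_dropDigits hpos (summable_digitTerm hb) (k + 1))
      (fun h => hbz (evZero_of_evZero_dropDigits h))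
    linarith
end

section
/- Let p ≥ 1 be an integer and let α be the unique zero in [1,2) of the polynomial X^p − X^{p−1} − ⋯ − X − 1. Let B = (β_{p−1},…,β_0) and Γ = (γ_{p−1},…,γ_0) be alternate bases of length p such that β_i > α for every i ∈ {0,…,p−1}. If for every i ∈ {0,…,p−1} there is a sequence 𝐭_i of nonnegative integers which is simultaneously the greedy S^i(B)-expansion of 1 and the greedy S^i(Γ)-expansion of 1 (i.e., 𝐭_i is lexicographically greatest among sequences with val_{S^i(B)}-value 1, and also lexicographically greatest among sequences with val_{S^i(Γ)}-value 1), then γ_i = β_i for all i ∈ {0,…,p−1}. -/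
/-- Remainder after `m` digits when `1` is expanded with digits `t` in the base `S^n(B)`. -/
noncomputable def remainderOne (B : ℤ → ℝ) (n : ℤ) (t : ℕ → ℕ) : ℕ → ℝ
  | 0 => 1
  | m + 1 => B (n - 1 - m) * remainderOne B n t m - t m

/-- Remainders of the greedy algorithm in the base `S^n(B)` started at `x`. -/
noncomputable def greedyRemainder (B : ℤ → ℝ) (n : ℤ) (x : ℝ) : ℕ → ℝ
  | 0 => x
  | k + 1 => Int.fract (B (n - 1 - k) * greedyRemainder B n x k)

theorem exists_representative_of_periodic {p : ℕ} (hp : 1 ≤ p) (n : ℤ) :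
    ∃ i : ℕ, i < p ∧ ∀ f : ℤ → ℝ, (∀ m, f (m + p) = f m) → f n = f i := by
  have hp0 : (0 : ℤ) < p := by exact_mod_cast hp
  have h0 := Int.emod_nonneg n hp0.ne'
  have h1 := Int.emod_lt_of_pos n hp0
  refine ⟨(n % p).toNat, by omega, fun f hf => ?_⟩
  have hper : Function.Periodic f (p : ℤ) := hf
  have h2 := hper.int_mul (n / p) (n % p)
  rw [Int.toNat_of_nonneg h0, ← h2]
  congr 1
  have := Int.emod_add_mul_ediv n p
  push_cast
  linarith

theorem exists_lower_bound_of_periodic {p : ℕ} (hp : 1 ≤ p) {B : ℤ → ℝ} {a : ℝ}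
    (hB : ∀ i : ℕ, i < p → a < B i) (hper : ∀ n, B (n + p) = B n) :
    ∃ c, a < c ∧ ∀ n, c ≤ B n := by
  obtain ⟨k, hk, hmin⟩ := Finset.exists_min_image (Finset.range p) (fun i : ℕ => B i)
    ⟨0, Finset.mem_range.2 hp⟩
  refine ⟨B k, hB k (by simpa using hk), fun n => ?_⟩
  obtain ⟨i, hi, h⟩ := exists_representative_of_periodic hp n
  rw [h B hper]
  exact hmin i (by simpa using hi)

theorem sum_add_remainderOne_div {B : ℤ → ℝ} (hB : ∀ n, 1 < B n) (n : ℤ) (t : ℕ → ℕ) (m : ℕ) :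
    ∑ j ∈ Finset.range m, (t j : ℝ) / ∏ i ∈ Finset.range (j + 1), B (n - 1 - i)
      + remainderOne B n t m / ∏ i ∈ Finset.range m, B (n - 1 - i) = 1 := by
  induction m with
  | zero => simp [remainderOne]
  | succ m ih =>
    rw [← ih, Finset.sum_range_succ, Finset.prod_range_succ, remainderOne]
    have h1 : ∏ i ∈ Finset.range m, B (n - 1 - i) ≠ 0 :=
      Finset.prod_ne_zero_iff.2 fun i _ => (zero_lt_one.trans (hB _)).ne'
    have h2 : B (n - 1 - m) ≠ 0 := (zero_lt_one.trans (hB _)).ne'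
    field_simp
    ring

theorem digit_div_nonneg {B : ℤ → ℝ} (hB : ∀ n, 1 < B n) (n : ℤ) (t : ℕ → ℕ) (j : ℕ) :
    0 ≤ (t j : ℝ) / ∏ i ∈ Finset.range (j + 1), B (n - 1 - i) :=
  div_nonneg (Nat.cast_nonneg _) (Finset.prod_nonneg fun _ _ => (zero_lt_one.trans (hB _)).le)

theorem remainderOne_nonneg {B : ℤ → ℝ} (hB : ∀ n, 1 < B n) {n : ℤ} {t : ℕ → ℕ}
    (ht : valS B n t = 1) (m : ℕ) : 0 ≤ remainderOne B n t m := by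
  have hs : Summable fun j : ℕ => (t j : ℝ) / ∏ i ∈ Finset.range (j + 1), B (n - 1 - i) := by
    by_contra h
    rw [valS, tsum_eq_zero_of_not_summable h] at ht
    exact zero_ne_one ht
  have h1 := hs.sum_le_tsum (Finset.range m) fun j _ => digit_div_nonneg hB n t j
  rw [valS] at ht
  rw [ht] at h1
  have h2 := sum_add_remainderOne_div hB n t m
  have h3 : 0 < ∏ i ∈ Finset.range m, B (n - 1 - i) :=
    Finset.prod_pos fun _ _ => zero_lt_one.trans (hB _)
  by_contra! h
  have := div_neg_of_neg_of_pos h h3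
  linarith

theorem valS_eq_one_of_remainderOne_mem_Icc {B : ℤ → ℝ} {c : ℝ} (hc : 1 < c) (hB : ∀ n, c ≤ B n)
    {n : ℤ} {t : ℕ → ℕ} {N : ℕ} (h0 : ∀ m ≥ N, 0 ≤ remainderOne B n t m)
    (h1 : ∀ m ≥ N, remainderOne B n t m ≤ 1) : valS B n t = 1 := by
  have hB1 : ∀ n, 1 < B n := fun n => hc.trans_le (hB n)
  have hprod : ∀ m : ℕ, c ^ m ≤ ∏ i ∈ Finset.range m, B (n - 1 - i) := fun m => by
    simpa using Finset.prod_le_prod (s := Finset.range m) (f := fun _ => c)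
      (fun _ _ => (zero_lt_one.trans hc).le) fun i _ => hB (n - 1 - i)
  have hcpos : ∀ m : ℕ, 0 < c ^ m := fun m => pow_pos (zero_lt_one.trans hc) m
  have hlim : Filter.Tendsto
      (fun m => remainderOne B n t m / ∏ i ∈ Finset.range m, B (n - 1 - i))
      Filter.atTop (nhds 0) := by
    refine squeeze_zero' (Filter.eventually_atTop.2 ⟨N, fun m hm => ?_⟩)
      (Filter.eventually_atTop.2 ⟨N, fun m hm => ?_⟩)
      (tendsto_pow_atTop_nhds_zero_of_lt_one (r := c⁻¹) (by positivity) (inv_lt_one_of_one_lt₀ hc))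
    · exact div_nonneg (h0 m hm) ((hcpos m).le.trans (hprod m))
    · rw [inv_pow, ← one_div]
      exact div_le_div₀ zero_le_one (h1 m hm) (hcpos m) (hprod m)
  refine HasSum.tsum_eq ((hasSum_iff_tendsto_nat_of_nonneg (digit_div_nonneg hB1 n t) 1).2 ?_)
  have h := (tendsto_const_nhds (x := (1 : ℝ))).sub hlim
  rw [sub_zero] at h
  exact h.congr fun m => by linarith [sum_add_remainderOne_div hB1 n t m]

theorem exists_lexLt_of_one_lt_remainderOne {B : ℤ → ℝ} {c : ℝ} (hc : 1 < c) (hB : ∀ n, c ≤ B n)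
    {n : ℤ} {t : ℕ → ℕ} {m : ℕ} (hm : 1 < remainderOne B n t (m + 1)) :
    ∃ b : ℕ → ℕ, valS B n b = 1 ∧ (∀ j < m, b j = t j) ∧ t m < b m := by
  set y := greedyRemainder B (n - (m + 1)) (remainderOne B n t (m + 1) - 1) with hy
  have hy0 : ∀ k, 0 ≤ y k
    | 0 => by simp only [hy, greedyRemainder]; linarith
    | k + 1 => Int.fract_nonneg _
  set b : ℕ → ℕ := fun j => if j < m then t j else if j = m then t m + 1 else
    ⌊B (n - 1 - j) * y (j - (m + 1))⌋₊ with hb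
  have hfirst : ∀ j ≤ m, remainderOne B n b j = remainderOne B n t j := by
    intro j
    induction j with
    | zero => intro _; rfl
    | succ j ih =>
      intro hj
      have : b j = t j := if_pos (by omega)
      rw [remainderOne, remainderOne, ih (by omega), this]
  have hlast : ∀ k, remainderOne B n b (m + 1 + k) = y k := by
    intro k
    induction k with
    | zero =>
      have : b m = t m + 1 := by simp [hb]
      simp only [add_zero, hy, greedyRemainder]
      rw [remainderOne, remainderOne, hfirst m le_rfl, this]
      push_cast
      ring
    | succ k ih =>
      have hbk : b (m + 1 + k) = ⌊B (n - 1 - (m + 1 + k : ℕ)) * y k⌋₊ := by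
        simp only [hb]
        rw [if_neg (by omega), if_neg (by omega)]
        congr
        omega
      have hidx : (n - 1 - (m + 1 + k : ℕ) : ℤ) = n - (m + 1) - 1 - k := by push_cast; ring
      have hnn : 0 ≤ B (n - 1 - (m + 1 + k : ℕ)) * y k :=
        mul_nonneg (zero_le_one.trans (hc.le.trans (hB _))) (hy0 k)
      rw [← add_assoc, remainderOne, ih, hbk, natCast_floor_eq_intCast_floor hnn, hidx]
      exact Int.self_sub_floor _
  refine ⟨b, valS_eq_one_of_remainderOne_mem_Icc hc hB (N := m + 2) ?_ ?_,
    fun j hj => if_pos hj, by simp [hb]⟩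
  · intro j hj
    obtain ⟨k, rfl⟩ := Nat.exists_eq_add_of_le hj
    rw [show m + 2 + k = m + 1 + (k + 1) by ring, hlast]
    exact hy0 _
  · intro j hj
    obtain ⟨k, rfl⟩ := Nat.exists_eq_add_of_le hj
    rw [show m + 2 + k = m + 1 + (k + 1) by ring, hlast]
    exact (Int.fract_lt_one _).le

theorem IsGreedyOne.remainderOne_le_one {B : ℤ → ℝ} {c : ℝ} (hc : 1 < c) (hB : ∀ n, c ≤ B n)
    {n : ℤ} {t : ℕ → ℕ} (ht : IsGreedyOne B n t) : ∀ m, remainderOne B n t m ≤ 1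
  | 0 => le_rfl
  | m + 1 => by
    by_contra! h
    obtain ⟨b, hb1, heq, hlt⟩ := exists_lexLt_of_one_lt_remainderOne hc hB h
    rcases ht.2 b hb1 with rfl | ⟨j, hj, hjlt⟩
    · exact hlt.false
    · rcases lt_trichotomy j m with hjm | rfl | hjm
      · exact hjlt.ne (heq j hjm)
      · omega
      · exact hlt.ne' (hj m hjm)

theorem sum_pow_lt_pow_of_root_lt {p : ℕ} (hp : 1 ≤ p) {α b : ℝ} (hα : 1 ≤ α)
    (hroot : α ^ p = ∑ j ∈ Finset.range p, α ^ j) (hb : α < b) :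
    ∑ j ∈ Finset.range p, b ^ j < b ^ p := by
  have hα0 : 0 < α := by linarith
  have hb0 : 0 < b := hα0.trans hb
  have h : ∑ j ∈ Finset.range p, α ^ p * b ^ j < ∑ j ∈ Finset.range p, b ^ p * α ^ j := by
    refine Finset.sum_lt_sum_of_nonempty ⟨0, Finset.mem_range.2 hp⟩ fun j hj => ?_
    obtain ⟨k, rfl⟩ := Nat.exists_eq_add_of_lt (Finset.mem_range.1 hj)
    have := pow_lt_pow_left₀ hb hα0.le (n := k + 1) (by omega)
    have h2 : 0 < α ^ j * b ^ j := by positivity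
    calc α ^ (j + k + 1) * b ^ j = α ^ j * b ^ j * α ^ (k + 1) := by ring
      _ < α ^ j * b ^ j * b ^ (k + 1) := by gcongr
      _ = b ^ (j + k + 1) * α ^ j := by ring
  rw [← Finset.mul_sum, ← Finset.mul_sum, ← hroot, mul_comm (b ^ p)] at h
  exact lt_of_mul_lt_mul_left h (by positivity)

theorem sum_pow_lt_pow_of_le {p : ℕ} {b : ℝ} (hb : 0 < b)
    (h : ∑ j ∈ Finset.range p, b ^ j < b ^ p) {r : ℕ} (hr : r ≤ p) :
    ∑ j ∈ Finset.range r, b ^ j < b ^ r := by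
  induction hr using Nat.decreasingInduction with
  | self => exact h
  | of_succ r _ ih =>
    rw [geom_sum_succ, pow_succ'] at ih
    exact lt_of_mul_lt_mul_left (by linarith) hb.le

/-- A sequence expanding by a factor at least `b`, with a loss of at most `E` at the indices not
divisible by `p`, cannot be bounded once it has reached `E` at index `1`. -/
theorem not_bddAbove_of_expanding {p : ℕ} (hp : 1 ≤ p) {b E : ℝ} (hb : 1 ≤ b) (hE : 0 < E)
    (h : ∑ j ∈ Finset.range p, b ^ j < b ^ p) {X g : ℕ → ℝ} (hg : ∀ m, b ≤ g m) (hX : E ≤ X 1)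
    (hoff : ∀ m, g m * X m - E ≤ X (m + 1)) (hdiag : ∀ k, g (k * p) * X (k * p) ≤ X (k * p + 1)) :
    ¬ BddAbove (Set.range X) := by
  set H : ℕ → ℝ := fun r => b ^ r - ∑ j ∈ Finset.range r, b ^ j with hH
  have hHpos : ∀ r ≤ p, 0 < H r := fun r hr =>
    sub_pos.2 (sum_pow_lt_pow_of_le (by linarith) h hr)
  have hHsucc : ∀ r, b * H r = H (r + 1) + 1 := fun r => by
    simp only [hH]
    rw [geom_sum_succ, pow_succ']
    ring
  have hmul : ∀ (k r m : ℕ), r ≤ p → E * (H r + k * H p) ≤ X m →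
      E * (H (r + 1) + 1 + k * H p) ≤ g m * X m := by
    intro k r m hr hm
    have hp' := hHpos p le_rfl
    have hr' := hHpos r hr
    have hk : 0 ≤ k * H p := by positivity
    have h1 : 0 ≤ E * (H r + k * H p) := by positivity
    calc E * (H (r + 1) + 1 + k * H p) = E * (b * H r + k * H p) := by rw [hHsucc]
      _ ≤ E * (b * H r + b * (k * H p)) := by
          have := le_mul_of_one_le_left hk hb
          gcongr
      _ = b * (E * (H r + k * H p)) := by ring
      _ ≤ g m * X m := mul_le_mul (hg m) hm h1 (by linarith [hg m])
  have hblock : ∀ k : ℕ, E * (H 0 + k * H p) ≤ X (k * p + 1) →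
      ∀ r < p, E * (H r + k * H p) ≤ X (k * p + 1 + r) := by
    intro k hk r
    induction r with
    | zero => exact fun _ => hk
    | succ r ih =>
      intro hr
      have h1 := hmul k r _ (by omega) (ih (by omega))
      have h2 := hoff (k * p + 1 + r)
      rw [← add_assoc]
      linarith
  have hmain : ∀ k : ℕ, E * (H 0 + k * H p) ≤ X (k * p + 1) := by
    intro k
    induction k with
    | zero => simpa [hH] using hX
    | succ k ih =>
      have h1 := hmul k (p - 1) _ (by omega) (hblock k ih (p - 1) (by omega))
      have h2 : k * p + 1 + (p - 1) = (k + 1) * p := by rw [add_mul]; omega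
      rw [h2, Nat.sub_add_cancel hp] at h1
      have h3 := hdiag (k + 1)
      have h4 : H 0 = 1 := by simp [hH]
      rw [h4]
      push_cast at h1 h3 ⊢
      linarith
  rintro ⟨C, hC⟩
  have hp' := hHpos p le_rfl
  obtain ⟨k, hk⟩ := exists_nat_gt (C / (E * H p))
  rw [div_lt_iff₀ (by positivity)] at hk
  have h1 := hC ⟨k * p + 1, rfl⟩
  have h2 := hmain k
  have h3 : 0 < E * H 0 := mul_pos hE (hHpos 0 (by omega))
  linarith

theorem stmt5 (p : ℕ) (hp : 1 ≤ p) (α : ℝ)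
    (hα1 : 1 ≤ α) (hα2 : α < 2)
    (hαroot : α ^ p = ∑ j ∈ Finset.range p, α ^ j)
    (β γ : ℤ → ℝ)
    (hβ1 : ∀ n, 1 < β n) (hβper : ∀ n, β (n + p) = β n)
    (hγ1 : ∀ n, 1 < γ n) (hγper : ∀ n, γ (n + p) = γ n)
    (hβα : ∀ i : ℕ, i < p → α < β i)
    (ht : ∀ i : ℕ, i < p → ∃ t : ℕ → ℕ, IsGreedyOne β i t ∧ IsGreedyOne γ i t) :
    ∀ i : ℕ, i < p → γ i = β i := by
  obtain ⟨b, hb, hβb⟩ := exists_lower_bound_of_periodic hp hβα hβper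
  obtain ⟨c, hc, hγc⟩ := exists_lower_bound_of_periodic hp (fun i _ => hγ1 i) hγper
  have hb1 : 1 < b := hα1.trans_lt hb
  obtain ⟨k, hk, hmax⟩ := Finset.exists_max_image (Finset.range p) (fun i : ℕ => |γ i - β i|)
    ⟨0, Finset.mem_range.2 hp⟩
  by_contra! hne
  obtain ⟨i₀, hi₀, hne⟩ := hne
  have hE : 0 < |γ k - β k| :=
    (abs_pos.2 (sub_ne_zero.2 hne)).trans_le (hmax i₀ (by simpa using hi₀))
  have hεper : ∀ m : ℤ, γ (m + p) - β (m + p) = γ m - β m := fun m => by rw [hγper, hβper]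
  have hle : ∀ m, |γ m - β m| ≤ |γ k - β k| := fun m => by
    obtain ⟨j, hj, h⟩ := exists_representative_of_periodic hp m
    rw [h _ hγper, h _ hβper]
    exact hmax j (by simpa using hj)
  obtain ⟨i, hi, hrep⟩ := exists_representative_of_periodic hp ((k : ℤ) + 1)
  obtain ⟨t, htβ, htγ⟩ := ht i hi
  have hdiag : ∀ l : ℕ, γ (i - 1 - (l * p : ℕ)) - β (i - 1 - (l * p : ℕ)) = γ k - β k := by
    intro l
    have hper : Function.Periodic (fun m : ℤ => γ m - β m) (p : ℤ) := hεper
    have h1 := hper.sub_zsmul_eq (x := (i : ℤ) - 1) l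
    have h2 := hrep (fun m => γ (m - 1) - β (m - 1)) fun m => by
      have := hεper (m - 1)
      rwa [sub_add_eq_add_sub] at this
    simp only [add_sub_cancel_right] at h2
    rw [h2, ← h1]
    simp
  obtain ⟨s, hs, hsk⟩ : ∃ s : ℝ, |s| = 1 ∧ s * (γ k - β k) = |γ k - β k| := by
    rcases abs_choice (γ k - β k) with h | h
    · exact ⟨1, by simp, by rw [one_mul, h]⟩
    · exact ⟨-1, by simp, by rw [neg_one_mul, h]⟩
  have hβ0 := remainderOne_nonneg hβ1 htβ.1
  have hγ0 := remainderOne_nonneg hγ1 htγ.1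
  have hβle := htβ.remainderOne_le_one hb1 hβb
  have hγle := htγ.remainderOne_le_one hc hγc
  have hrec : ∀ m : ℕ, s * (remainderOne γ i t (m + 1) - remainderOne β i t (m + 1)) =
      β (i - 1 - m) * (s * (remainderOne γ i t m - remainderOne β i t m)) +
        s * (γ (i - 1 - m) - β (i - 1 - m)) * remainderOne γ i t m := fun m => by
    rw [remainderOne, remainderOne]
    ring
  refine not_bddAbove_of_expanding hp hb1.le hE (sum_pow_lt_pow_of_root_lt hp hα1 hαroot hb)
    (X := fun m => s * (remainderOne γ i t m - remainderOne β i t m))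
    (g := fun m => β (i - 1 - m)) (fun m => hβb _) ?_ (fun m => ?_) (fun l => ?_)
    ⟨1, ?_⟩
  · have h1 := hrec 0
    have h2 := hdiag 0
    rw [zero_mul] at h2
    rw [h2, hsk] at h1
    refine (h1.trans ?_).ge
    simp [remainderOne]
  · have h1 : |s * (γ (i - 1 - m) - β (i - 1 - m)) * remainderOne γ i t m| ≤ |γ k - β k| := by
      rw [abs_mul, abs_mul, hs, one_mul, abs_of_nonneg (hγ0 m)]
      exact (mul_le_of_le_one_right (abs_nonneg _) (hγle m)).trans (hle _)
    have h2 := (abs_le.1 h1).1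
    have h3 := hrec m
    linarith
  · have h1 := hrec (l * p)
    rw [hdiag, hsk] at h1
    have h2 := mul_nonneg hE.le (hγ0 (l * p))
    linarith
  · rintro _ ⟨m, rfl⟩
    refine (le_abs_self _).trans ?_
    rw [abs_mul, hs, one_mul, abs_le]
    constructor <;> linarith [hβ0 m, hγ0 m, hβle m, hγle m]
end

section
/- Let p ≥ 1 be an integer and let α be the unique zero in [1,2) of the polynomial X^p − X^{p−1} − ⋯ − X − 1. Let B = (β_{p−1},…,β_0) and Γ = (γ_{p−1},…,γ_0) be alternate bases of length p such that β_i > α for every i ∈ {0,…,p−1}. If for every i ∈ {0,…,p−1} there is a sequence 𝐝_i of nonnegative integers, not ending in a tail of zeros, which is simultaneously the quasi-greedy S^i(B)-expansion of 1 and the quasi-greedy S^i(Γ)-expansion of 1 (i.e., 𝐝_i is lexicographically greatest among sequences not ending in a tail of zeros with val_{S^i(B)}-value 1, and also among those with val_{S^i(Γ)}-value 1), then γ_i = β_i for all i ∈ {0,…,p−1}. -/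
/-- The remainders of an expansion of `x` with digits `a` in the shifted base `S^n(B)`. -/
noncomputable def remainder (B : ℤ → ℝ) (n : ℤ) (a : ℕ → ℕ) (x : ℝ) : ℕ → ℝ
  | 0 => x
  | j + 1 => B (n - 1 - j) * remainder B n a x j - a j

/-- The remainders of the quasi-greedy algorithm applied to `x` in the base `S^n(B)`. -/
noncomputable def quasiGreedyRemainder (B : ℤ → ℝ) (n : ℤ) (x : ℝ) : ℕ → ℝ
  | 0 => x
  | j + 1 => B (n - 1 - j) * quasiGreedyRemainder B n x j
      - (⌈B (n - 1 - j) * quasiGreedyRemainder B n x j⌉₊ - 1 : ℕ)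

/-- The digits of the quasi-greedy algorithm applied to `x` in the base `S^n(B)`. -/
noncomputable def quasiGreedyDigit (B : ℤ → ℝ) (n : ℤ) (x : ℝ) (j : ℕ) : ℕ :=
  ⌈B (n - 1 - j) * quasiGreedyRemainder B n x j⌉₊ - 1

lemma remainder_quasiGreedyDigit (B : ℤ → ℝ) (n : ℤ) (x : ℝ) (j : ℕ) :
    remainder B n (quasiGreedyDigit B n x) x j = quasiGreedyRemainder B n x j := by
  induction j with
  | zero => rfl
  | succ j ih => simp only [remainder, quasiGreedyRemainder, ih, quasiGreedyDigit]

lemma sub_ceil_sub_one_mem_Ioc {y : ℝ} (hy : 0 < y) :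
    y - (⌈y⌉₊ - 1 : ℕ) ∈ Set.Ioc (0 : ℝ) 1 := by
  have h1 : 0 < ⌈y⌉₊ := Nat.ceil_pos.2 hy
  have h2 := Nat.le_ceil y
  have h3 := Nat.ceil_lt_add_one hy.le
  rw [Nat.cast_sub h1, Nat.cast_one]
  constructor <;> linarith

lemma quasiGreedyRemainder_pos {B : ℤ → ℝ} (hB : ∀ n, 1 < B n) (n : ℤ) {x : ℝ} (hx : 0 < x)
    (j : ℕ) : 0 < quasiGreedyRemainder B n x j := by
  induction j with
  | zero => exact hx
  | succ j ih =>
    exact (sub_ceil_sub_one_mem_Ioc (mul_pos (zero_lt_one.trans (hB (n - 1 - j))) ih)).1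

lemma quasiGreedyRemainder_le_one {B : ℤ → ℝ} (hB : ∀ n, 1 < B n) (n : ℤ) {x : ℝ} (hx : 0 < x)
    (j : ℕ) : quasiGreedyRemainder B n x (j + 1) ≤ 1 :=
  (sub_ceil_sub_one_mem_Ioc (mul_pos (zero_lt_one.trans (hB (n - 1 - j)))
    (quasiGreedyRemainder_pos hB n hx j))).2

lemma prod_base_pos {B : ℤ → ℝ} (hB : ∀ n, 1 < B n) (n : ℤ) (j : ℕ) :
    0 < ∏ i ∈ Finset.range j, B (n - 1 - i) :=
  Finset.prod_pos fun _ _ => zero_lt_one.trans (hB _)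

lemma remainder_eq {B : ℤ → ℝ} (hB : ∀ n, 1 < B n) (n : ℤ) (a : ℕ → ℕ) (x : ℝ) (j : ℕ) :
    remainder B n a x j = (∏ i ∈ Finset.range j, B (n - 1 - i)) *
      (x - ∑ k ∈ Finset.range j, (a k : ℝ) / ∏ i ∈ Finset.range (k + 1), B (n - 1 - i)) := by
  induction j with
  | zero => simp [remainder]
  | succ j ih =>
    have h1 := (prod_base_pos hB n j).ne'
    have h2 : B (n - 1 - j) ≠ 0 := (zero_lt_one.trans (hB _)).ne'
    rw [remainder, ih, Finset.sum_range_succ, Finset.prod_range_succ]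
    field_simp
    ring

/-- In a base bounded away from `1`, every positive number has an expansion
which does not end in a tail of zeros. -/
lemma exists_hasSum_not_evZero {B : ℤ → ℝ} {ρ : ℝ} (hρ : 1 < ρ) (hB : ∀ n, ρ ≤ B n) (n : ℤ)
    {x : ℝ} (hx : 0 < x) : ∃ c : ℕ → ℕ, ¬ EvZero c ∧
      HasSum (fun j => (c j : ℝ) / ∏ i ∈ Finset.range (j + 1), B (n - 1 - i)) x := by
  have hB1 : ∀ n, 1 < B n := fun n => hρ.trans_le (hB n)
  have key : ∀ j, ∑ k ∈ Finset.range j,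
      (quasiGreedyDigit B n x k : ℝ) / ∏ i ∈ Finset.range (k + 1), B (n - 1 - i)
        = x - quasiGreedyRemainder B n x j / ∏ i ∈ Finset.range j, B (n - 1 - i) := by
    intro j
    rw [← remainder_quasiGreedyDigit, remainder_eq hB1,
      mul_div_cancel_left₀ _ (prod_base_pos hB1 n j).ne']
    ring
  have hsum : HasSum (fun j => (quasiGreedyDigit B n x j : ℝ) /
      ∏ i ∈ Finset.range (j + 1), B (n - 1 - i)) x := by
    rw [hasSum_iff_tendsto_nat_of_nonneg
      (fun j => div_nonneg (Nat.cast_nonneg _) (prod_base_pos hB1 n _).le)]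
    simp only [key]
    have h0 : Filter.Tendsto (fun j => quasiGreedyRemainder B n x j /
        ∏ i ∈ Finset.range j, B (n - 1 - i)) Filter.atTop (nhds 0) := by
      have hgeo : Filter.Tendsto (fun j : ℕ => ρ⁻¹ ^ j) Filter.atTop (nhds 0) :=
        tendsto_pow_atTop_nhds_zero_of_lt_one (by positivity) (inv_lt_one_of_one_lt₀ hρ)
      refine tendsto_of_tendsto_of_tendsto_of_le_of_le' tendsto_const_nhds hgeo
        (Filter.Eventually.of_forall fun j => div_nonneg
          (quasiGreedyRemainder_pos hB1 n hx j).le (prod_base_pos hB1 n j).le) ?_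
      filter_upwards [Filter.eventually_ge_atTop 1] with j hj
      obtain ⟨j, rfl⟩ := Nat.exists_eq_add_of_le' hj
      have hprod : ρ ^ (j + 1) ≤ ∏ i ∈ Finset.range (j + 1), B (n - 1 - i) := by
        calc ρ ^ (j + 1) = ∏ _i ∈ Finset.range (j + 1), ρ := by simp
          _ ≤ _ := Finset.prod_le_prod (fun _ _ => by positivity) (fun _ _ => hB _)
      rw [inv_pow, ← one_div]
      exact div_le_div₀ zero_le_one (quasiGreedyRemainder_le_one hB1 n hx j)
        (by positivity) hprod
    simpa using h0.const_sub x
  refine ⟨_, ?_, hsum⟩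
  rintro ⟨N, hN⟩
  have hfin := hasSum_sum_of_ne_finset_zero (L := .unconditional ℕ) (f := fun j => (quasiGreedyDigit B n x j : ℝ) /
      ∏ i ∈ Finset.range (j + 1), B (n - 1 - i)) (s := Finset.range N) (by
    intro j hj
    simp [hN j (by simpa using hj)])
  have heq := hsum.unique hfin
  rw [key] at heq
  have := div_pos (quasiGreedyRemainder_pos hB1 n hx N) (prod_base_pos hB1 n N)
  linarith

lemma IsQuasiGreedyOne.hasSum {B : ℤ → ℝ} {n : ℤ} {d : ℕ → ℕ} (h : IsQuasiGreedyOne B n d) :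
    HasSum (fun j => (d j : ℝ) / ∏ i ∈ Finset.range (j + 1), B (n - 1 - i)) 1 := by
  have h1 : ∑' j : ℕ, (d j : ℝ) / ∏ i ∈ Finset.range (j + 1), B (n - 1 - i) = 1 := h.2.1
  rw [← h1]
  refine Summable.hasSum ?_
  by_contra hs
  rw [tsum_eq_zero_of_not_summable hs] at h1
  exact zero_ne_one h1

lemma IsQuasiGreedyOne.remainder_nonneg {B : ℤ → ℝ} (hB : ∀ n, 1 < B n) {n : ℤ} {d : ℕ → ℕ}
    (h : IsQuasiGreedyOne B n d) (j : ℕ) : 0 ≤ remainder B n d 1 j := by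
  rw [remainder_eq hB]
  refine mul_nonneg (prod_base_pos hB n j).le (sub_nonneg.2 ?_)
  exact sum_le_hasSum _ (fun k _ => div_nonneg (Nat.cast_nonneg _) (prod_base_pos hB n _).le)
    h.hasSum

lemma IsQuasiGreedyOne.remainder_le_one {B : ℤ → ℝ} {ρ : ℝ} (hρ : 1 < ρ) (hB : ∀ n, ρ ≤ B n)
    {n : ℤ} {d : ℕ → ℕ} (h : IsQuasiGreedyOne B n d) (j : ℕ) : remainder B n d 1 j ≤ 1 := by
  have hB1 : ∀ n, 1 < B n := fun n => hρ.trans_le (hB n)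
  cases j with
  | zero => exact le_rfl
  | succ j =>
    by_contra! hlt
    obtain ⟨c, hc, hcsum⟩ := exists_hasSum_not_evZero hρ hB (n - (j + 1 : ℕ)) (sub_pos.2 hlt)
    set P := ∏ i ∈ Finset.range (j + 1), B (n - 1 - i) with hP
    have hPpos : 0 < P := prod_base_pos hB1 n (j + 1)
    let b : ℕ → ℕ := fun k => if k < j then d k else if k = j then d j + 1 else c (k - (j + 1))
    have hbj : b j = d j + 1 := by simp [b]
    have hb_lt : ∀ k < j, b k = d k := fun k hk => by simp [b, hk]
    have hb_add : ∀ k, b (k + (j + 1)) = c k := fun k => by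
      simp [b, show ¬ k + (j + 1) < j by omega, show k + (j + 1) ≠ j by omega]
    have hbz : ¬ EvZero b := by
      rintro ⟨N, hN⟩
      exact hc ⟨N, fun k hk => by rw [← hb_add]; exact hN _ (by omega)⟩
    have hbsum : HasSum (fun k => (b k : ℝ) / ∏ i ∈ Finset.range (k + 1), B (n - 1 - i)) 1 := by
      rw [← hasSum_nat_add_iff' (j + 1)]
      have hval : 1 - ∑ k ∈ Finset.range (j + 1),
          (b k : ℝ) / ∏ i ∈ Finset.range (k + 1), B (n - 1 - i)
            = P⁻¹ * (remainder B n d 1 (j + 1) - 1) := by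
        rw [remainder_eq hB1, ← hP, Finset.sum_range_succ, Finset.sum_range_succ, ← hP, hbj,
          Finset.sum_congr rfl (fun k hk => by rw [hb_lt k (Finset.mem_range.1 hk)])]
        push_cast
        field_simp
        ring
      rw [hval]
      refine (congrArg (fun g : ℕ → ℝ => HasSum g _) (funext fun k => ?_)).mpr
        (hcsum.mul_left P⁻¹)
      rw [hb_add, show k + (j + 1) + 1 = (j + 1) + (k + 1) by ring, Finset.prod_range_add, ← hP,
        div_eq_mul_inv, mul_inv, div_eq_mul_inv]
      have : ∀ i : ℕ, B (n - 1 - ((j + 1 + i : ℕ) : ℤ)) = B (n - ((j + 1 : ℕ) : ℤ) - 1 - i) :=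
        fun i => by congr 1; push_cast; ring
      simp only [this]
      ring
    rcases h.2.2 b hbz hbsum.tsum_eq with heq | ⟨m, hm, hlt'⟩
    · have := congrFun heq j
      omega
    · rcases lt_trichotomy m j with hmj | rfl | hmj
      · have := hb_lt m hmj
        omega
      · omega
      · have := hm j hmj
        omega

/-- A perturbed expansion recursion in which the errors at multiples of `p` dominate
has unbounded solutions. -/
lemma linear_growth {p : ℕ} (hp : 1 ≤ p) {α : ℝ} (hα1 : 1 ≤ α)
    (hα : α ^ p = ∑ j ∈ Finset.range p, α ^ j) {E : ℝ} (hE : 0 < E) {b f q η : ℕ → ℝ}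
    (hb : ∀ j, α < b j) (hbp : ∀ m, b (m * p) = b 0) (hf : ∀ j, |f j| ≤ E)
    (hfp : ∀ m, f (m * p) = E) (hq0 : q 0 = 1) (hq : ∀ j, 0 ≤ q j) (hq1 : ∀ j, q j ≤ 1)
    (hη0 : η 0 = 0) (hη : ∀ j, η (j + 1) = b j * (η j + f j * q j)) (m : ℕ) :
    E + m * ((b 0 - α) * E) ≤ η (m * p) + E * q (m * p) := by
  have hα0 : 0 < α := zero_lt_one.trans_le hα1
  let w : ℕ → ℝ := fun l => α ^ l - ∑ j ∈ Finset.range l, α ^ j + 1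
  have hw_succ : ∀ l, w (l + 1) = α * (w l - 1) := by
    intro l
    simp only [w, Finset.sum_range_succ', pow_succ, ← Finset.sum_mul]
    ring
  have hwp : w p = 1 := by simp [w, hα]
  have hw : ∀ l ≤ p, 1 ≤ w l := by
    intro l hl
    induction hl using Nat.decreasingInduction with
    | self => exact hwp.ge
    | of_succ l _ ih =>
      rw [hw_succ] at ih
      have : 0 < w l - 1 := pos_of_mul_pos_right (zero_lt_one.trans_le ih) hα0.le
      linarith
  have hc : 0 < (b 0 - α) * E := mul_pos (sub_pos.2 (hb 0)) hE
  induction m with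
  | zero => simp [hη0, hq0]
  | succ m ih =>
    set c := (b 0 - α) * E with hcdef
    have hmc : 0 ≤ (m : ℝ) * c := by positivity
    have hstep : ∀ l, l + 1 ≤ p → E * w (l + 1) + (m + 1) * c ≤ η (m * p + (l + 1)) := by
      intro l
      induction l with
      | zero =>
        intro _
        rw [← add_assoc, add_zero, hη, hfp, hbp]
        have hw1 : w (0 + 1) = α := by simp [w]
        rw [hw1]
        have h1 := mul_le_mul_of_nonneg_left ih (hα0.trans (hb 0)).le
        have h2 : (m : ℝ) * c ≤ b 0 * (m * c) :=
          le_mul_of_one_le_left hmc (hα1.trans (hb 0).le)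
        nlinarith
      | succ l ihl =>
        intro hl
        have h1 := ihl (by omega)
        have h2 := hw (l + 1) (by omega)
        rw [← add_assoc, hη, hw_succ]
        set j := m * p + (l + 1)
        have h3 : -E ≤ f j * q j := by
          have h4 : |f j * q j| ≤ E * 1 := by
            rw [abs_mul, abs_of_nonneg (hq j)]
            exact mul_le_mul (hf j) (hq1 j) (hq j) hE.le
          linarith [(abs_le.1 h4).1]
        have h5 : E * (w (l + 1) - 1) + (m + 1) * c ≤ η j + f j * q j := by linarith
        have h6 : 0 ≤ E * (w (l + 1) - 1) + (m + 1) * c := by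
          have := mul_nonneg hE.le (sub_nonneg.2 h2)
          linarith
        have h7 : (m + 1) * c ≤ α * ((m + 1) * c) :=
          le_mul_of_one_le_left (by linarith) hα1
        calc E * (α * (w (l + 1) - 1)) + (m + 1) * c
            ≤ α * (E * (w (l + 1) - 1) + (m + 1) * c) := by linarith
          _ ≤ b j * (η j + f j * q j) :=
            mul_le_mul (hb j).le h5 h6 (hα0.trans (hb j)).le
    have h := hstep (p - 1) (by omega)
    rw [Nat.sub_add_cancel hp, hwp, ← Nat.succ_mul] at h
    have := mul_nonneg hE.le (hq ((m + 1) * p))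
    push_cast
    rw [Nat.succ_eq_add_one] at h
    linarith

lemma exists_natCast_lt_eq {p : ℕ} (hp : 1 ≤ p) (n : ℤ) :
    ∃ i : ℕ, i < p ∧ ∃ t : ℤ, n = i + t * p := by
  have hp0 : (0 : ℤ) < p := by exact_mod_cast hp
  refine ⟨(n % p).toNat, ?_, n / p, ?_⟩
  · have := Int.emod_lt_of_pos n hp0
    have := Int.emod_nonneg n hp0.ne'
    omega
  · rw [Int.toNat_of_nonneg (Int.emod_nonneg n hp0.ne'), mul_comm, Int.emod_add_mul_ediv]

lemma periodic_add_mul {B : ℤ → ℝ} {p : ℕ} (h : ∀ n, B (n + p) = B n) (n t : ℤ) :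
    B (n + t * p) = B n := by
  have := Function.Periodic.int_mul (f := B) (c := (p : ℤ)) h t n
  simpa using this

lemma exists_one_lt_forall_le {B : ℤ → ℝ} {p : ℕ} (hp : 1 ≤ p) (hB : ∀ n, 1 < B n)
    (h : ∀ n, B (n + p) = B n) : ∃ ρ : ℝ, 1 < ρ ∧ ∀ n, ρ ≤ B n := by
  obtain ⟨k, -, hmin⟩ := Finset.exists_min_image (Finset.range p) (fun i : ℕ => B i)
    ⟨0, Finset.mem_range.2 hp⟩
  refine ⟨B k, hB k, fun n => ?_⟩
  obtain ⟨i, hi, t, rfl⟩ := exists_natCast_lt_eq hp n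
  rw [periodic_add_mul h]
  exact hmin i (Finset.mem_range.2 hi)

lemma valS_add_mul {B : ℤ → ℝ} {p : ℕ} (h : ∀ n, B (n + p) = B n) (n t : ℤ) :
    valS B (n + t * p) = valS B n := by
  have hs : ∀ i : ℕ, B (n + t * p - 1 - i) = B (n - 1 - i) := fun i => by
    rw [← periodic_add_mul h (n - 1 - i) t]
    congr 1
    ring
  funext a
  simp only [valS, hs]

lemma IsQuasiGreedyOne.add_mul {B : ℤ → ℝ} {p : ℕ} (h : ∀ n, B (n + p) = B n) {n : ℤ}
    {d : ℕ → ℕ} (hd : IsQuasiGreedyOne B n d) (t : ℤ) : IsQuasiGreedyOne B (n + t * p) d := by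
  simpa only [IsQuasiGreedyOne, valS_add_mul h] using hd

theorem stmt6 (p : ℕ) (hp : 1 ≤ p) (α : ℝ)
    (hα1 : 1 ≤ α) (hα2 : α < 2)
    (hαroot : α ^ p = ∑ j ∈ Finset.range p, α ^ j)
    (β γ : ℤ → ℝ)
    (hβ1 : ∀ n, 1 < β n) (hβper : ∀ n, β (n + p) = β n)
    (hγ1 : ∀ n, 1 < γ n) (hγper : ∀ n, γ (n + p) = γ n)
    (hβα : ∀ i : ℕ, i < p → α < β i)
    (hd : ∀ i : ℕ, i < p → ∃ d : ℕ → ℕ, IsQuasiGreedyOne β i d ∧ IsQuasiGreedyOne γ i d) :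
    ∀ i : ℕ, i < p → γ i = β i := by
  let e : ℤ → ℝ := fun n => (γ n - β n) / β n
  have heper : ∀ n, e (n + p) = e n := fun n => by simp only [e, hβper, hγper]
  have hβ0 : ∀ n, β n ≠ 0 := fun n => (zero_lt_one.trans (hβ1 n)).ne'
  have hβα' : ∀ n, α < β n := fun n => by
    obtain ⟨i, hi, t, rfl⟩ := exists_natCast_lt_eq hp n
    rw [periodic_add_mul hβper]
    exact hβα i hi
  obtain ⟨k, -, hmax⟩ := Finset.exists_max_image (Finset.range p) (fun i : ℕ => |e i|)
    ⟨0, Finset.mem_range.2 hp⟩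
  have hemax : ∀ n, |e n| ≤ |e k| := fun n => by
    obtain ⟨i, hi, t, rfl⟩ := exists_natCast_lt_eq hp n
    rw [periodic_add_mul heper]
    exact hmax i (Finset.mem_range.2 hi)
  suffices hek : e k = 0 by
    intro i _
    have h := hemax i
    rw [hek, abs_zero] at h
    have h0 : (γ i - β i) / β i = 0 := abs_nonpos_iff.1 h
    exact sub_eq_zero.1 ((div_eq_zero_iff.1 h0).resolve_right (hβ0 _))
  by_contra hek
  have hE : 0 < |e k| := abs_pos.2 hek
  obtain ⟨s, hs1, hs⟩ : ∃ s : ℝ, |s| = 1 ∧ s * e k = |e k| := by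
    rcases abs_choice (e k) with h | h
    · exact ⟨1, by simp, by rw [h, one_mul]⟩
    · exact ⟨-1, by simp, by rw [h, neg_one_mul]⟩
  obtain ⟨d, hdβ, hdγ⟩ : ∃ d, IsQuasiGreedyOne β (k + 1) d ∧ IsQuasiGreedyOne γ (k + 1) d := by
    obtain ⟨i, hi, t, hit⟩ := exists_natCast_lt_eq hp (k + 1)
    obtain ⟨d, h1, h2⟩ := hd i hi
    rw [hit]
    exact ⟨d, h1.add_mul hβper t, h2.add_mul hγper t⟩
  obtain ⟨ρ, hρ, hρβ⟩ := exists_one_lt_forall_le hp hβ1 hβper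
  obtain ⟨σ, hσ, hσγ⟩ := exists_one_lt_forall_le hp hγ1 hγper
  have hr0 := hdβ.remainder_nonneg hβ1
  have hr1 := hdβ.remainder_le_one hρ hρβ
  have hq0 := hdγ.remainder_nonneg hγ1
  have hq1 := hdγ.remainder_le_one hσ hσγ
  set r := remainder β (k + 1) d 1
  set q := remainder γ (k + 1) d 1
  have hmul : ∀ (B : ℤ → ℝ), (∀ n, B (n + p) = B n) → ∀ m : ℕ,
      B ((k : ℤ) + 1 - 1 - (m * p : ℕ)) = B k := fun B hB m => by
    rw [← periodic_add_mul hB k (-m)]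
    congr 1
    push_cast
    ring
  have hgrow := linear_growth hp hα1 hαroot hE (b := fun j => β ((k : ℤ) + 1 - 1 - j))
    (f := fun j => s * e ((k : ℤ) + 1 - 1 - j)) (q := q) (η := fun j => s * (q j - r j))
    (fun j => hβα' _) (fun m => by simpa using hmul β hβper m)
    (fun j => by rw [abs_mul, hs1, one_mul]; exact hemax _)
    (fun m => by rw [hmul e heper, hs]) rfl hq0 hq1 (by simp [q, r, remainder])
    (fun j => by
      simp only [q, r, remainder, e]
      have := hβ0 ((k : ℤ) + 1 - 1 - j)
      field_simp
      ring)
  have hc : 0 < (β ((k : ℤ) + 1 - 1 - (0 : ℕ)) - α) * |e k| :=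
    mul_pos (sub_pos.2 (hβα' _)) hE
  obtain ⟨m, hm⟩ := exists_nat_gt (1 / ((β ((k : ℤ) + 1 - 1 - (0 : ℕ)) - α) * |e k|))
  rw [div_lt_iff₀ hc] at hm
  have h1 := hgrow m
  have h2 : s * (q (m * p) - r (m * p)) ≤ 1 := by
    refine (le_abs_self _).trans ?_
    rw [abs_mul, hs1, one_mul, abs_le]
    constructor <;> linarith [hr0 (m * p), hr1 (m * p), hq0 (m * p), hq1 (m * p)]
  have h3 : |e k| * q (m * p) ≤ |e k| * 1 := mul_le_mul_of_nonneg_left (hq1 _) hE.le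
  linarith
end

section
/- Let k ≥ 1 and let (A_n)_{n∈ℕ} be a sequence of k×k matrices with nonnegative integer entries. Assume there exist a k×k matrix P all of whose entries are positive and indices i_1 < j_1 ≤ i_2 < j_2 ≤ ⋯ such that A_{j_r−1}A_{j_r−2}⋯A_{i_r} = P for every r ≥ 1. Then there exists a row vector f ∈ ℝ_{≥0}^k such that ⋂_{n≥0} { x·A_{n−1}⋯A_0 : x ∈ ℝ_{≥0}^k } = { c·f : c ∈ ℝ_{≥0} } (for n = 0 the empty product of matrices is the identity, so the n = 0 term of the intersection is ℝ_{≥0}^k itself). -/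
/-- The product `A (j-1) * A (j-2) * ⋯ * A i` (the empty product being the identity). -/
def matProdN (k : ℕ) (A : ℕ → Matrix (Fin k) (Fin k) ℕ) (i j : ℕ) :
    Matrix (Fin k) (Fin k) ℕ :=
  ((List.range (j - i)).map (fun m => A (j - 1 - m))).prod

open Matrix in
/-- A matrix `B` contracts relative oscillation by the factor `θ`: if `u` lies between two multiples
of the nonnegative vector `v`, then `u ᵥ* B` lies between two multiples of `v ᵥ* B` whose distance
is smaller by the factor `θ`. -/
def ContractsOscillation {k : ℕ} (θ : ℝ) (B : Matrix (Fin k) (Fin k) ℝ) : Prop :=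
  ∀ u v : Fin k → ℝ, 0 ≤ v → ∀ a b : ℝ, a • v ≤ u → u ≤ b • v →
    ∃ a' b' : ℝ, b' - a' ≤ θ * (b - a) ∧ a' • (v ᵥ* B) ≤ u ᵥ* B ∧ u ᵥ* B ≤ b' • (v ᵥ* B)

section

open Matrix

theorem matProdN_self (k : ℕ) (A : ℕ → Matrix (Fin k) (Fin k) ℕ) (i : ℕ) :
    matProdN k A i i = 1 := by
  simp [matProdN]

theorem matProdN_succ (k : ℕ) (A : ℕ → Matrix (Fin k) (Fin k) ℕ) {i j : ℕ} (h : i ≤ j) :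
    matProdN k A i (j + 1) = A j * matProdN k A i j := by
  unfold matProdN
  rw [Nat.succ_sub h, List.range_succ_eq_map, List.map_cons, List.prod_cons, List.map_map]
  congr 3
  funext m
  simp only [Function.comp_apply]
  congr 1
  omega

theorem matProdN_mul (k : ℕ) (A : ℕ → Matrix (Fin k) (Fin k) ℕ) {i m j : ℕ}
    (him : i ≤ m) (hmj : m ≤ j) :
    matProdN k A i j = matProdN k A m j * matProdN k A i m := by
  induction j, hmj using Nat.le_induction with
  | base => rw [matProdN_self, one_mul]
  | succ j hmj ih => rw [matProdN_succ k A (him.trans hmj), matProdN_succ k A hmj, ih, mul_assoc]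

variable {k : ℕ}

theorem map_natCast_mul (M N : Matrix (Fin k) (Fin k) ℕ) :
    (M * N).map (Nat.cast : ℕ → ℝ) = M.map (Nat.cast : ℕ → ℝ) * N.map (Nat.cast : ℕ → ℝ) :=
  Matrix.map_mul (f := Nat.castRingHom ℝ)

theorem vecMul_nonneg_of_nonneg {B : Matrix (Fin k) (Fin k) ℝ} (hB : ∀ i j, 0 ≤ B i j)
    {u : Fin k → ℝ} (hu : 0 ≤ u) : 0 ≤ u ᵥ* B :=
  fun j => dotProduct_nonneg_of_nonneg hu fun i => hB i j

theorem vecMul_le_vecMul_of_nonneg {B : Matrix (Fin k) (Fin k) ℝ} (hB : ∀ i j, 0 ≤ B i j)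
    {u v : Fin k → ℝ} (h : u ≤ v) : u ᵥ* B ≤ v ᵥ* B :=
  fun j => dotProduct_le_dotProduct_of_nonneg_right h fun i => hB i j

theorem ContractsOscillation.of_nonneg {B : Matrix (Fin k) (Fin k) ℝ} (hB : ∀ i j, 0 ≤ B i j) :
    ContractsOscillation 1 B := by
  intro u v _ a b ha hb
  refine ⟨a, b, by simp, ?_, ?_⟩
  · rw [← smul_vecMul]
    exact vecMul_le_vecMul_of_nonneg hB ha
  · rw [← smul_vecMul]
    exact vecMul_le_vecMul_of_nonneg hB hb

theorem ContractsOscillation.mul {θ η : ℝ} {B C : Matrix (Fin k) (Fin k) ℝ}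
    (hB : ContractsOscillation θ B) (hC : ContractsOscillation η C) (hη : 0 ≤ η)
    (hB0 : ∀ i j, 0 ≤ B i j) : ContractsOscillation (θ * η) (B * C) := by
  intro u v hv a b ha hb
  obtain ⟨a₁, b₁, h₁, ha₁, hb₁⟩ := hB u v hv a b ha hb
  obtain ⟨a₂, b₂, h₂, ha₂, hb₂⟩ := hC _ _ (vecMul_nonneg_of_nonneg hB0 hv) a₁ b₁ ha₁ hb₁
  refine ⟨a₂, b₂, ?_, ?_, ?_⟩
  · nlinarith [mul_le_mul_of_nonneg_left h₁ hη]
  · simpa only [vecMul_vecMul] using ha₂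
  · simpa only [vecMul_vecMul] using hb₂

theorem sum_le_vecMul {Q : Matrix (Fin k) (Fin k) ℝ} (hQ : ∀ i j, 1 ≤ Q i j) {u : Fin k → ℝ}
    (hu : 0 ≤ u) (j : Fin k) : ∑ i, u i ≤ (u ᵥ* Q) j :=
  Finset.sum_le_sum fun i _ => le_mul_of_one_le_right (hu i) (hQ i j)

theorem vecMul_le_mul_sum {Q : Matrix (Fin k) (Fin k) ℝ} {M : ℝ} (hQ : ∀ i j, Q i j ≤ M)
    {u : Fin k → ℝ} (hu : 0 ≤ u) (j : Fin k) : (u ᵥ* Q) j ≤ M * ∑ i, u i := by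
  rw [mul_comm, Finset.sum_mul]
  exact dotProduct_le_dotProduct_of_nonneg_left (fun i => hQ i j) hu

theorem ContractsOscillation.of_mem_Icc {Q : Matrix (Fin k) (Fin k) ℝ} {M : ℝ} (hM : 0 < M)
    (hQ1 : ∀ i j, 1 ≤ Q i j) (hQM : ∀ i j, Q i j ≤ M) :
    ContractsOscillation (1 - 1 / M) Q := by
  intro u v hv a b ha hb
  rcases (Finset.sum_nonneg fun i _ => hv i : 0 ≤ ∑ i, v i).eq_or_lt with h0 | hpos
  · have hv0 : v = 0 := by
      funext i
      exact (Finset.sum_eq_zero_iff_of_nonneg fun i _ => hv i).1 h0.symm i (Finset.mem_univ i)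
    subst hv0
    have hu0 : u = 0 := le_antisymm (by simpa using hb) (by simpa using ha)
    subst hu0
    exact ⟨0, (1 - 1 / M) * (b - a), by simp, by simp, by simp⟩
  · set t := ∑ i, v i with ht
    set s := ∑ i, u i with hs
    have hsa : a * t ≤ s := by
      rw [ht, Finset.mul_sum]
      exact Finset.sum_le_sum fun i _ => ha i
    have hsb : s ≤ b * t := by
      rw [ht, Finset.mul_sum]
      exact Finset.sum_le_sum fun i _ => hb i
    have hvM : ∀ j, (v ᵥ* Q) j / M ≤ t := fun j => by
      rw [div_le_iff₀ hM, mul_comm]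
      exact vecMul_le_mul_sum hQM hv j
    have hst : s / t * t = s := div_mul_cancel₀ _ hpos.ne'
    have ha' : 0 ≤ s / t - a := by rw [sub_nonneg, le_div_iff₀ hpos]; exact hsa
    have hb' : 0 ≤ b - s / t := by rw [sub_nonneg, div_le_iff₀ hpos]; exact hsb
    refine ⟨a + (s / t - a) / M, b - (b - s / t) / M, le_of_eq (by ring), fun j => ?_, fun j => ?_⟩
    · have h1 := sum_le_vecMul hQ1 (sub_nonneg.2 ha) j
      simp only [sub_vecMul, smul_vecMul, Pi.sub_apply, Pi.smul_apply, smul_eq_mul,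
        Finset.sum_sub_distrib, ← Finset.mul_sum] at h1
      have h2 := mul_le_mul_of_nonneg_left (hvM j) ha'
      calc (a + (s / t - a) / M) * (v ᵥ* Q) j
          = a * (v ᵥ* Q) j + (s / t - a) * ((v ᵥ* Q) j / M) := by ring
        _ ≤ (u ᵥ* Q) j := by linarith
    · have h1 := sum_le_vecMul hQ1 (sub_nonneg.2 hb) j
      simp only [sub_vecMul, smul_vecMul, Pi.sub_apply, Pi.smul_apply, smul_eq_mul,
        Finset.sum_sub_distrib, ← Finset.mul_sum] at h1
      have h2 := mul_le_mul_of_nonneg_left (hvM j) hb'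
      calc (u ᵥ* Q) j ≤ b * (v ᵥ* Q) j - (b - s / t) * ((v ᵥ* Q) j / M) := by linarith
        _ = (b - (b - s / t) / M) * (v ᵥ* Q) j := by ring

/-- Two nonnegative vectors in the image of `Q * B`, where `Q` has entries in `[1, M]` and `B`
contracts oscillation by `θ`, have small `2 × 2` minors. -/
theorem abs_minor_le {Q B : Matrix (Fin k) (Fin k) ℝ} {M θ : ℝ} (hM : 0 < M) (hθ : 0 ≤ θ)
    (hQ1 : ∀ i j, 1 ≤ Q i j) (hQM : ∀ i j, Q i j ≤ M) (hB0 : ∀ i j, 0 ≤ B i j)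
    (hB : ContractsOscillation θ B) {u v : Fin k → ℝ} (hu : 0 ≤ u) (hv : 0 ≤ v)
    {y z : Fin k → ℝ} (hy : u ᵥ* (Q * B) = y) (hz : v ᵥ* (Q * B) = z)
    {i : Fin k} (hi : 0 < z i) (j : Fin k) :
    |y i * z j - y j * z i| ≤ θ * (M * (M * (y i / z i))) * (z i * z j) := by
  have hQ0 : ∀ i j, 0 ≤ Q i j := fun i j => zero_le_one.trans (hQ1 i j)
  rw [← vecMul_vecMul] at hy hz
  have hzj : 0 ≤ z j := by
    rw [← hz]
    exact vecMul_nonneg_of_nonneg hB0 (vecMul_nonneg_of_nonneg hQ0 hv) j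
  set s := ∑ i, u i with hs
  set t := ∑ i, v i with ht
  have ht0 : 0 ≤ t := Finset.sum_nonneg fun i _ => hv i
  have hs0 : 0 ≤ s := Finset.sum_nonneg fun i _ => hu i
  have htpos : 0 < t := by
    refine ht0.lt_of_ne fun h => hi.ne' ?_
    have hv0 : v = 0 := by
      funext i
      exact (Finset.sum_eq_zero_iff_of_nonneg fun i _ => hv i).1 h.symm i (Finset.mem_univ i)
    simp [← hz, hv0]
  have hst : s / t * t = s := div_mul_cancel₀ _ htpos.ne'
  have hr : 0 ≤ s / t := div_nonneg hs0 ht0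
  have hlow : (s / t / M) • (v ᵥ* Q) ≤ u ᵥ* Q := fun l => by
    have h2 := mul_le_mul_of_nonneg_left (vecMul_le_mul_sum hQM hv l) (div_nonneg hr hM.le)
    calc (s / t / M) * (v ᵥ* Q) l ≤ s / t / M * (M * t) := h2
      _ = s := by field_simp
      _ ≤ (u ᵥ* Q) l := sum_le_vecMul hQ1 hu l
  have hupp : u ᵥ* Q ≤ (M * (s / t)) • (v ᵥ* Q) := fun l => by
    have h2 := mul_le_mul_of_nonneg_left (sum_le_vecMul hQ1 hv l) (mul_nonneg hM.le hr)
    calc (u ᵥ* Q) l ≤ M * s := vecMul_le_mul_sum hQM hu l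
      _ = M * (s / t) * t := by rw [mul_assoc, hst]
      _ ≤ M * (s / t) * (v ᵥ* Q) l := h2
  have hratio : s / t ≤ M * (y i / z i) := by
    have h := vecMul_le_vecMul_of_nonneg hB0 hlow i
    rw [smul_vecMul, hy, hz, Pi.smul_apply, smul_eq_mul, ← le_div_iff₀ hi, div_le_iff₀ hM] at h
    linarith
  obtain ⟨a, b, hab, ha, hb⟩ :=
    hB _ _ (vecMul_nonneg_of_nonneg hQ0 hv) _ _ hlow hupp
  rw [hy, hz] at ha hb
  have hε : b - a ≤ θ * (M * (M * (y i / z i))) := by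
    refine hab.trans (mul_le_mul_of_nonneg_left ?_ hθ)
    have := mul_le_mul_of_nonneg_left hratio hM.le
    have := div_nonneg hr hM.le
    linarith
  refine le_trans ?_ (mul_le_mul_of_nonneg_right hε (mul_nonneg hi.le hzj))
  have hai : a * z i ≤ y i := ha i
  have haj : a * z j ≤ y j := ha j
  have hbi : y i ≤ b * z i := hb i
  have hbj : y j ≤ b * z j := hb j
  rw [abs_le]
  constructor <;>
  nlinarith [mul_le_mul_of_nonneg_right hai hzj, mul_le_mul_of_nonneg_right hbi hzj,
    mul_le_mul_of_nonneg_right haj hi.le, mul_le_mul_of_nonneg_right hbj hi.le]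

theorem contractsOscillation_matProdN {A : ℕ → Matrix (Fin k) (Fin k) ℕ}
    {P : Matrix (Fin k) (Fin k) ℕ} {idx jdx : ℕ → ℕ}
    (hij : ∀ r, idx r < jdx r) (hji : ∀ r, jdx r ≤ idx (r + 1))
    (hprod : ∀ r, matProdN k A (idx r) (jdx r) = P) {θ : ℝ} (hθ : 0 ≤ θ)
    (hP : ContractsOscillation θ (P.map (Nat.cast : ℕ → ℝ))) (r : ℕ) :
    ContractsOscillation (θ ^ r) ((matProdN k A 0 (idx r)).map (Nat.cast : ℕ → ℝ)) := by
  have hnn (N : Matrix (Fin k) (Fin k) ℕ) (i j : Fin k) : 0 ≤ N.map (Nat.cast : ℕ → ℝ) i j :=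
    Nat.cast_nonneg _
  induction r with
  | zero => simpa using ContractsOscillation.of_nonneg (hnn _)
  | succ r ih =>
    rw [matProdN_mul k A (Nat.zero_le _) (hji r), matProdN_mul k A (Nat.zero_le _) (hij r).le,
      hprod, map_natCast_mul, map_natCast_mul]
    have := (ContractsOscillation.of_nonneg (hnn (matProdN k A (jdx r) (idx (r + 1))))).mul
      (hP.mul ih (pow_nonneg hθ r) (hnn P)) (mul_nonneg hθ (pow_nonneg hθ r)) (hnn _)
    rwa [one_mul, ← pow_succ'] at this

end

theorem stmt8 (k : ℕ) (hk : 1 ≤ k) (A : ℕ → Matrix (Fin k) (Fin k) ℕ)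
    (P : Matrix (Fin k) (Fin k) ℕ) (hP : ∀ i j, 0 < P i j)
    (idx jdx : ℕ → ℕ)
    (hij : ∀ r, idx r < jdx r) (hji : ∀ r, jdx r ≤ idx (r + 1))
    (hprod : ∀ r, matProdN k A (idx r) (jdx r) = P) :
    ∃ f : Fin k → ℝ, (∀ i, 0 ≤ f i) ∧
      (⋂ n : ℕ, (fun x : Fin k → ℝ =>
          Matrix.vecMul x ((matProdN k A 0 n).map (Nat.cast : ℕ → ℝ))) ''
        {x : Fin k → ℝ | ∀ i, 0 ≤ x i})
      = {y : Fin k → ℝ | ∃ c : ℝ, 0 ≤ c ∧ y = c • f} := by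
  set K := ⋂ n : ℕ, (fun x : Fin k → ℝ =>
      Matrix.vecMul x ((matProdN k A 0 n).map (Nat.cast : ℕ → ℝ))) ''
    {x : Fin k → ℝ | ∀ i, 0 ≤ x i} with hK
  have hnn (N : Matrix (Fin k) (Fin k) ℕ) (i j : Fin k) : 0 ≤ N.map (Nat.cast : ℕ → ℝ) i j :=
    Nat.cast_nonneg _
  have hmem {y : Fin k → ℝ} (hy : y ∈ K) (n : ℕ) : ∃ x : Fin k → ℝ, 0 ≤ x ∧
      Matrix.vecMul x ((matProdN k A 0 n).map (Nat.cast : ℕ → ℝ)) = y :=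
    Set.mem_iInter.1 hy n
  have hKnn {y : Fin k → ℝ} (hy : y ∈ K) : 0 ≤ y := by
    obtain ⟨x, hx, rfl⟩ := hmem hy 0
    exact vecMul_nonneg_of_nonneg (hnn _) hx
  have hsmul {y : Fin k → ℝ} (hy : y ∈ K) {c : ℝ} (hc : 0 ≤ c) : c • y ∈ K := by
    refine Set.mem_iInter.2 fun n => ?_
    obtain ⟨x, hx, hxy⟩ := hmem hy n
    exact ⟨c • x, fun i => mul_nonneg hc (hx i), by simp only [Matrix.smul_vecMul, hxy]⟩
  by_cases hne : ∃ z ∈ K, z ≠ 0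
  · obtain ⟨z, hz, hz0⟩ := hne
    obtain ⟨i, hi⟩ := Function.ne_iff.1 hz0
    have hzi : 0 < z i := lt_of_le_of_ne (hKnn hz i) (Ne.symm hi)
    refine ⟨z, hKnn hz, Set.Subset.antisymm (fun y hy => ?_) ?_⟩
    · refine ⟨y i / z i, div_nonneg (hKnn hy i) hzi.le, ?_⟩
      set M : ℝ := ∑ p, ∑ q, (P p q : ℝ) with hMdef
      have hQ1 : ∀ p q, (1 : ℝ) ≤ P.map (Nat.cast : ℕ → ℝ) p q := fun p q => by
        simpa using Nat.one_le_iff_ne_zero.2 (hP p q).ne'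
      have hQM : ∀ p q, P.map (Nat.cast : ℕ → ℝ) p q ≤ M := fun p q =>
        (Finset.single_le_sum (f := fun q => (P p q : ℝ)) (fun _ _ => Nat.cast_nonneg _)
          (Finset.mem_univ q)).trans
        (Finset.single_le_sum (f := fun p => ∑ q, (P p q : ℝ))
          (fun _ _ => Finset.sum_nonneg fun _ _ => Nat.cast_nonneg _) (Finset.mem_univ p))
      have hM1 : 1 ≤ M := (hQ1 i i).trans (hQM i i)
      have hM : 0 < M := zero_lt_one.trans_le hM1
      have hθ0 : 0 ≤ 1 - 1 / M := sub_nonneg.2 ((div_le_one hM).2 hM1)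
      have hθ1 : 1 - 1 / M < 1 := sub_lt_self _ (one_div_pos.2 hM)
      have hbound (j : Fin k) (r : ℕ) : |y i * z j - y j * z i| ≤
          (1 - 1 / M) ^ r * (M * (M * (y i / z i))) * (z i * z j) := by
        obtain ⟨u, hu, huy⟩ := hmem hy (jdx r)
        obtain ⟨v, hv, hvz⟩ := hmem hz (jdx r)
        rw [matProdN_mul k A (Nat.zero_le _) (hij r).le, hprod, map_natCast_mul] at huy hvz
        exact abs_minor_le hM (pow_nonneg hθ0 r) hQ1 hQM (hnn _)
          (contractsOscillation_matProdN hij hji hprod hθ0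
            (ContractsOscillation.of_mem_Icc hM hQ1 hQM) r) hu hv huy hvz hzi j
      funext j
      have hlim : Filter.Tendsto (fun r : ℕ =>
          (1 - 1 / M) ^ r * (M * (M * (y i / z i))) * (z i * z j)) Filter.atTop (nhds 0) := by
        simpa using ((tendsto_pow_atTop_nhds_zero_of_lt_one hθ0 hθ1).mul_const
          (M * (M * (y i / z i)))).mul_const (z i * z j)
      have h0 := abs_nonpos_iff.1 (ge_of_tendsto' hlim (hbound j))
      rw [Pi.smul_apply, smul_eq_mul, div_mul_eq_mul_div, eq_div_iff hzi.ne']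
      linarith
    · rintro _ ⟨c, hc, rfl⟩
      exact hsmul hz hc
  · push Not at hne
    refine ⟨0, fun _ => le_rfl, Set.Subset.antisymm (fun y hy => ⟨0, le_rfl, ?_⟩) ?_⟩
    · rw [hne y hy, smul_zero]
    · rintro _ ⟨c, -, rfl⟩
      rw [smul_zero]
      exact Set.mem_iInter.2 fun n => ⟨0, fun _ => le_rfl, Matrix.zero_vecMul _⟩
end

section
/- Let k ≥ 2, let h ∈ {1,…,k−1}, and let (A_n)_{n∈ℤ} be a sequence of k×k matrices with nonnegative integer entries of the form (A_n)_{i,j} = a_{n,j} if i = 1; 1 if i = j+1; 1 if i = h+1 and j = k; 0 otherwise, where a_{n,1} ≥ 1 for all n. Assume there exist a k×k matrix P with all entries positive and indices i_1 < j_1 ≤ i_2 < j_2 ≤ ⋯ in ℕ with A_{j_r−1}⋯A_{i_r} = P for every r ≥ 1. Let (γ_n)_{n∈ℤ} be positive reals and (f_n)_{n∈ℤ} row vectors in ℝ_{≥0}^k with first entry 1 satisfying γ_n·f_{n−1} = f_n·A_n for all n ∈ ℤ, and write f_n = (f_{n,1},…,f_{n,k}). Then for all n ∈ ℤ: (1)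 γ_n > 1; (2) 1 = ∑_{j=1}^{h} a_{n+j,j}/(γ_{n+1}⋯γ_{n+j}) + f_{n+h,h+1}/(γ_{n+1}⋯γ_{n+h}); (3) f_{n+h,h+1} = ∑_{j=h+1}^{k} a_{n+j,j}/(γ_{n+h+1}⋯γ_{n+j}) + f_{n+k,h+1}/(γ_{n+h+1}⋯γ_{n+k}). -/
/-- The product `A (j-1) * A (j-2) * ⋯ * A i` of a `ℤ`-indexed sequence of matrices
(the empty product being the identity). -/
def matProdZ (k : ℕ) (A : ℤ → Matrix (Fin k) (Fin k) ℕ) (i j : ℤ) :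
    Matrix (Fin k) (Fin k) ℕ :=
  ((List.range (j - i).toNat).map (fun m => A (j - 1 - m))).prod

/-- Unrolling a first-order linear recurrence `g m * x m = b m + x (m + 1)`. -/
theorem eq_sum_div_prod_add_of_mul_eq_add (x g b : ℕ → ℝ) (hg : ∀ m, 0 < g m) (N : ℕ)
    (hx : ∀ m < N, g m * x m = b m + x (m + 1)) :
    x 0 = (∑ j ∈ Finset.range N, b j / ∏ i ∈ Finset.range (j + 1), g i) +
      x N / ∏ i ∈ Finset.range N, g i := by
  induction N with
  | zero => simp
  | succ N ih =>
    rw [ih fun m hm => hx m (by omega), Finset.sum_range_succ, add_assoc, ← add_div,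
      ← hx N (by omega), Finset.prod_range_succ, mul_comm (g N), mul_div_mul_right _ _ (hg N).ne']

/-- A family of row vectors satisfying `γ n • f (n - 1) = f n * A n` is mapped by a descending
product of the `A n` to a positive multiple of an earlier member of the family. -/
theorem exists_pos_vecMul_prod_eq_smul {k : ℕ} (A : ℤ → Matrix (Fin k) (Fin k) ℕ) (γ : ℤ → ℝ)
    (f : ℤ → Fin k → ℝ) (hγpos : ∀ n, 0 < γ n)
    (hrec : ∀ n : ℤ, γ n • f (n - 1) =
      Matrix.vecMul (f n) ((A n).map (Nat.cast : ℕ → ℝ))) (n : ℤ) (m : ℕ) :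
    ∃ c : ℝ, 0 < c ∧
      Matrix.vecMul (f n)
        ((((List.range m).map fun l : ℕ => A (n - l)).prod).map (Nat.cast : ℕ → ℝ)) =
          c • f (n - m) := by
  induction m with
  | zero => exact ⟨1, one_pos, by simp [Matrix.map_one]⟩
  | succ m ih =>
    obtain ⟨c, hc, hm⟩ := ih
    refine ⟨c * γ (n - m), mul_pos hc (hγpos _), ?_⟩
    have hmap (X Y : Matrix (Fin k) (Fin k) ℕ) : (X * Y).map (Nat.cast : ℕ → ℝ) =
        X.map (Nat.cast : ℕ → ℝ) * Y.map (Nat.cast : ℕ → ℝ) :=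
      Matrix.map_mul (f := Nat.castRingHom ℝ)
    rw [List.range_succ, List.map_append, List.prod_append, hmap, ← Matrix.vecMul_vecMul, hm,
      List.map_singleton, List.prod_singleton, Matrix.smul_vecMul, ← hrec, smul_smul]
    congr 2
    push_cast
    ring

theorem stmt10 (k : ℕ) (hk : 2 ≤ k) (h : ℕ) (hh1 : 1 ≤ h) (hh2 : h ≤ k - 1)
    (a : ℤ → ℕ → ℕ) (ha1 : ∀ n : ℤ, 1 ≤ a n 1)
    (A : ℤ → Matrix (Fin k) (Fin k) ℕ)
    (hA : ∀ n : ℤ, ∀ i j : Fin k, A n i j =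
      if (i : ℕ) = 0 then a n ((j : ℕ) + 1)
      else if (i : ℕ) = (j : ℕ) + 1 then 1
      else if (i : ℕ) = h ∧ (j : ℕ) = k - 1 then 1
      else 0)
    (P : Matrix (Fin k) (Fin k) ℕ) (hP : ∀ i j, 0 < P i j)
    (idx jdx : ℕ → ℕ)
    (hij : ∀ r, idx r < jdx r) (hji : ∀ r, jdx r ≤ idx (r + 1))
    (hprod : ∀ r, matProdZ k A (idx r) (jdx r) = P)
    (γ : ℤ → ℝ) (f : ℤ → Fin k → ℝ)
    (hγpos : ∀ n, 0 < γ n) (hfpos : ∀ n i, 0 ≤ f n i)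
    (hf1 : ∀ n, f n ⟨0, by omega⟩ = 1)
    (hrec : ∀ n : ℤ, γ n • f (n - 1) =
      Matrix.vecMul (f n) ((A n).map (Nat.cast : ℕ → ℝ))) :
    ∀ n : ℤ,
      (1 < γ n) ∧
      ((1 : ℝ) =
        (∑ j ∈ Finset.range h,
          (a (n + 1 + j) (j + 1) : ℝ) / ∏ i ∈ Finset.range (j + 1), γ (n + 1 + i)) +
        f (n + h) ⟨h, by omega⟩ / ∏ i ∈ Finset.range h, γ (n + 1 + i)) ∧
      (f (n + h) ⟨h, by omega⟩ =
        (∑ j ∈ Finset.range (k - h),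
          (a (n + h + 1 + j) (h + 1 + j) : ℝ) /
            ∏ i ∈ Finset.range (j + 1), γ (n + h + 1 + i)) +
        f (n + k) ⟨h, by omega⟩ / ∏ i ∈ Finset.range (k - h), γ (n + h + 1 + i)) := by
  have hcol (n : ℤ) (j j' : Fin k)
      (hj : (j' : ℕ) = j + 1 ∨ ((j : ℕ) = k - 1 ∧ (j' : ℕ) = h)) :
      γ n * f (n - 1) j = a n (j + 1) + f n j' := by
    have key := congrFun (hrec n) j
    have hne : (⟨0, by omega⟩ : Fin k) ≠ j' := by
      intro e
      have := congrArg Fin.val e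
      simp only at this
      omega
    simp only [Pi.smul_apply, smul_eq_mul, Matrix.vecMul, dotProduct, Matrix.map_apply] at key
    rw [key, Fintype.sum_eq_add _ _ hne, hf1, hA, hA]
    · have : (j' : ℕ) ≠ 0 := by omega
      rcases hj with hj | hj
      · simp [hj]
      · simp [hj.1, hj.2, show h ≠ 0 by omega]
    · rintro i ⟨hi0, hij'⟩
      have h0 : (i : ℕ) ≠ 0 := fun e => hi0 (Fin.ext e)
      have h1 : (i : ℕ) ≠ j' := fun e => hij' (Fin.ext e)
      have hi := i.isLt
      have hji' := j.isLt
      rw [hA, if_neg h0, if_neg (by omega), if_neg (by omega)]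
      simp
  let F : ℤ → ℕ → ℝ := fun n m => if hm : m < k then f n ⟨m, hm⟩ else f n ⟨h, by omega⟩
  have hF (n : ℤ) (m : ℕ) (hm : m < k) : F n m = f n ⟨m, hm⟩ := dif_pos hm
  have hFk (n : ℤ) : F n k = f n ⟨h, by omega⟩ := dif_neg (lt_irrefl k)
  have hstep (n : ℤ) (m : ℕ) (hm : m < k) :
      γ (n + 1) * F n m = a (n + 1) (m + 1) + F (n + 1) (m + 1) := by
    rw [hF n m hm]
    rcases Nat.lt_or_ge (m + 1) k with hm' | hm'
    · have := hcol (n + 1) ⟨m, hm⟩ ⟨m + 1, hm'⟩ (Or.inl rfl)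
      rw [add_sub_cancel_right] at this
      rw [this, hF _ _ hm']
    · obtain rfl : k = m + 1 := by omega
      have := hcol (n + 1) ⟨m, hm⟩ ⟨h, by omega⟩ (Or.inr ⟨rfl, rfl⟩)
      rw [add_sub_cancel_right] at this
      rw [this, hFk]
  have hdown (n : ℤ) (hn : ∀ i, 0 < f n i) : ∀ i, 0 < f (n - 1) i := by
    intro i
    have hi := i.isLt
    obtain ⟨j', hj'⟩ : ∃ j' : Fin k, (j' : ℕ) = i + 1 ∨ ((i : ℕ) = k - 1 ∧ (j' : ℕ) = h) := by
      rcases Nat.lt_or_ge (i + 1) k with hm' | hm'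
      · exact ⟨⟨i + 1, hm'⟩, Or.inl rfl⟩
      · exact ⟨⟨h, by omega⟩, Or.inr ⟨by omega, rfl⟩⟩
    refine pos_of_mul_pos_right ?_ (hγpos n).le
    rw [hcol n i j' hj']
    exact add_pos_of_nonneg_of_pos (Nat.cast_nonneg _) (hn j')
  have hposidx (r : ℕ) : ∀ i, 0 < f ((idx r : ℤ) - 1) i := by
    intro i
    obtain ⟨c, hc, hm⟩ := exists_pos_vecMul_prod_eq_smul A γ f hγpos hrec ((jdx r : ℤ) - 1)
      ((jdx r : ℤ) - idx r).toNat
    have hr := hij r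
    have hP' := hprod r
    simp only [matProdZ, List.bind_eq_flatMap, List.pure_def, ← List.map_eq_flatMap,
      List.map_map, Function.comp_def] at hP'
    rw [hP', show (jdx r : ℤ) - 1 - (((jdx r : ℤ) - idx r).toNat : ℤ) = idx r - 1 by omega] at hm
    refine pos_of_mul_pos_right (a := c) ?_ hc.le
    have key := congrFun hm i
    simp only [Pi.smul_apply, smul_eq_mul, Matrix.vecMul, dotProduct, Matrix.map_apply] at key
    rw [← key]
    refine Finset.sum_pos' (fun l _ => mul_nonneg (hfpos _ _) (Nat.cast_nonneg _))
      ⟨⟨0, by omega⟩, Finset.mem_univ _, ?_⟩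
    rw [hf1, one_mul]
    exact_mod_cast hP _ _
  have hidx : StrictMono idx := strictMono_nat_of_lt_succ fun r => (hij r).trans_le (hji r)
  have hpos (n : ℤ) : ∀ i, 0 < f n i := by
    have hiter (N : ℤ) (hN : ∀ i, 0 < f N i) (m : ℕ) : ∀ i, 0 < f (N - m) i := by
      induction m with
      | zero => simpa using hN
      | succ m ih =>
        have := hdown _ ih
        rwa [sub_sub, ← Nat.cast_succ] at this
    have hle := hidx.le_apply (x := (n + 1).toNat)
    have := hiter _ (hposidx (n + 1).toNat) ((idx (n + 1).toNat : ℤ) - 1 - n).toNat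
    rwa [show (idx (n + 1).toNat : ℤ) - 1 -
      (((idx (n + 1).toNat : ℤ) - 1 - n).toNat : ℤ) = n by omega] at this
  intro n
  refine ⟨?_, ?_, ?_⟩
  · have h1 := hcol n ⟨0, by omega⟩ ⟨1, by omega⟩ (Or.inl rfl)
    rw [hf1, mul_one] at h1
    have h2 : (1 : ℝ) ≤ a n 1 := by exact_mod_cast ha1 n
    have h3 := hpos n ⟨1, by omega⟩
    simp only [zero_add] at h1
    linarith
  · have key := eq_sum_div_prod_add_of_mul_eq_add (fun m => F (n + m) m)
      (fun m => γ (n + 1 + m)) (fun m => a (n + 1 + m) (m + 1)) (fun m => hγpos _) h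
      (fun m hm => by
        have := hstep (n + m) m (by omega)
        rw [add_right_comm n (m : ℤ) 1] at this
        rw [this, Nat.cast_succ, add_right_comm n 1 (m : ℤ), add_assoc n (m : ℤ) 1])
    simp only [hF _ 0 (by omega), hF _ h (by omega), hf1] at key
    exact key
  · have key := eq_sum_div_prod_add_of_mul_eq_add (fun m => F (n + h + m) (h + m))
      (fun m => γ (n + h + 1 + m)) (fun m => a (n + h + 1 + m) (h + 1 + m)) (fun m => hγpos _)
      (k - h)
      (fun m hm => by
        have := hstep (n + h + m) (h + m) (by omega)
        rw [add_right_comm (n + h) (m : ℤ) 1, add_right_comm h m 1] at this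
        rw [this, Nat.cast_succ, add_right_comm (n + h : ℤ) 1 (m : ℤ),
          add_assoc (n + h : ℤ) (m : ℤ) 1, add_right_comm h 1 m, add_assoc h m 1])
    have hk' : n + h + ((k - h : ℕ) : ℤ) = n + k := by omega
    simp only [Nat.cast_zero, add_zero, hF _ h (by omega), hk',
      Nat.add_sub_cancel' (show h ≤ k by omega), hFk] at key
    exact key
end
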